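/- arXiv:1804.00321 — 2 statements merged into one kernel-verified Lean document; each statement's English description precedes it below -/
import Mathlib

section
/- If p₁ and p₂ are odd primes with p₁ | a and p₂ | b, and Γ is a finite abelian group of order abc that is of odd order or has more than one involution, then there exists a Γ-magic rectangle set MRS_Γ(a,b;c). -/
open Finset

/-- A Γ-magic rectangle set MRS_Γ(a,b;c): c arrays of size a×b whose entries are the
elements of Γ, each appearing exactly once, with constant row sums and column sums. -/
def IsMagicRectangleSet {Γ : Type*} [AddCommGroup Γ] (a b c : ℕ)
    (x : Fin c → Fin a → Fin b → Γ) : Prop :=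
  Function.Bijective (fun q : Fin c × Fin a × Fin b => x q.1 q.2.1 q.2.2) ∧
  (∃ ω : Γ, ∀ s i, ∑ j, x s i j = ω) ∧
  (∃ δ : Γ, ∀ s j, ∑ i, x s i j = δ)

/-- Γ has more than one involution (element of order 2). -/
def HasMoreThanOneInvolution (Γ : Type*) [AddCommGroup Γ] : Prop :=
  ∃ i j : Γ, i ≠ j ∧ addOrderOf i = 2 ∧ addOrderOf j = 2

/-- Multiplying by the transposition of two points, if necessary, separates their cycles. -/
theorem Equiv.Perm.exists_not_sameCycle_swap {α : Type*} [DecidableEq α] [Finite α]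
    (f : Equiv.Perm α) {x y : α} (hxy : x ≠ y) :
    ¬ f.SameCycle x y ∨ ¬ (Equiv.swap x y * f).SameCycle x y := by
  have hex : ∃ n, 0 < n ∧ ((f ^ n) x = x ∨ (f ^ n) x = y) :=
    ⟨orderOf f, orderOf_pos f, by simp [pow_orderOf_eq_one]⟩
  classical
  obtain ⟨hn0, hn⟩ := Nat.find_spec hex
  have hmin : ∀ k, 0 < k → k < Nat.find hex → (f ^ k) x ≠ x ∧ (f ^ k) x ≠ y := by
    intro k hk hlt
    simpa [hk] using Nat.find_min hex hlt
  generalize Nat.find hex = n at hn0 hn hmin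
  have key : ∀ g : Equiv.Perm α, (g ^ n) x = x → (∀ k < n, (g ^ k) x = (f ^ k) x) →
      ¬ g.SameCycle x y := by
    intro g hg hgf h
    obtain ⟨i, hi⟩ := h.exists_nat_pow_eq
    have h1 : (g ^ (i % n)) x = y := by
      rw [← hi]
      conv_rhs => rw [← Nat.mod_add_div i n, pow_add, pow_mul, Equiv.Perm.mul_apply]
      rw [Equiv.Perm.pow_apply_eq_self_of_apply_eq_self hg]
    have hlt := Nat.mod_lt i hn0
    rw [hgf _ hlt] at h1
    rcases Nat.eq_zero_or_pos (i % n) with h0 | h0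
    · rw [h0] at h1
      exact hxy (by simpa using h1)
    · exact (hmin _ h0 hlt).2 h1
  rcases hn with hn | hn
  · exact Or.inl (key f hn fun _ _ => rfl)
  · right
    have hk : ∀ k < n, ((Equiv.swap x y * f) ^ k) x = (f ^ k) x := by
      intro k
      induction k with
      | zero => simp
      | succ k ih =>
        intro hlt
        rw [pow_succ', Equiv.Perm.mul_apply, ih (by omega), Equiv.Perm.mul_apply, pow_succ',
          Equiv.Perm.mul_apply]
        have := hmin (k + 1) (by omega) hlt
        rw [pow_succ', Equiv.Perm.mul_apply] at this
        exact Equiv.swap_apply_of_ne_of_ne this.1 this.2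
    refine key _ ?_ hk
    obtain ⟨m, rfl⟩ := Nat.exists_eq_succ_of_ne_zero hn0.ne'
    rw [pow_succ', Equiv.Perm.mul_apply, hk m (by omega), Equiv.Perm.mul_apply]
    rw [pow_succ', Equiv.Perm.mul_apply] at hn
    rw [hn, Equiv.swap_apply_right]

section Hall

variable {G : Type*} [AddCommGroup G] [Finite G]

theorem exists_perm_eq_add_insert_of_not_sameCycle (d : G → G) (S : Set G) (α β : Equiv.Perm G)
    (h : ∀ i ∈ S, α i = β i + d i) {i₀ i₁ : G} (hi₀ : i₀ ∉ S) (hi₁ : i₁ ∉ S) (hne : i₀ ≠ i₁)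
    (hc : ¬ Equiv.Perm.SameCycle ((Equiv.subLeft (β i₀ + β i₁ + d i₀)).trans (α.symm.trans β))
      (β i₀) (β i₁)) :
    ∃ α' β' : Equiv.Perm G, ∀ i ∈ insert i₀ S, α' i = β' i + d i := by
  classical
  set C := β i₀ + β i₁ + d i₀ with hC
  set F : Equiv.Perm G := (Equiv.subLeft C).trans (α.symm.trans β) with hF
  have hFa : ∀ p, F p = β (α.symm (C - p)) := fun p => rfl
  set A : Set G := {p | F.SameCycle (β i₁) p} with hA
  have hA₁ : β i₁ ∈ A := Equiv.Perm.SameCycle.refl _ _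
  have hA₀ : β i₀ ∉ A := fun h => hc (Equiv.Perm.SameCycle.symm h)
  have hAF : ∀ p, F p ∈ A ↔ p ∈ A := fun p => Equiv.Perm.sameCycle_apply_right
  have hAF' : ∀ p, F.symm p ∈ A ↔ p ∈ A := fun p => by rw [← hAF, Equiv.apply_symm_apply]
  have hβ : Function.Injective fun i => if β i ∈ A then F.symm (β i) else β i := by
    intro i j hij
    dsimp only at hij
    split_ifs at hij with h1 h2 h2
    · exact β.injective (F.symm.injective hij)
    · rw [← hAF' (β i), hij] at h1
      exact absurd h1 h2
    · rw [← hAF' (β j), ← hij] at h2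
      exact absurd h2 h1
    · exact β.injective hij
  have hmix : ∀ i j, β i ∈ A → C - β i = α j → β j ∈ A := by
    intro i j hi hij
    rw [← hAF, hFa, hij, Equiv.symm_apply_apply] at hi
    exact hi
  have hγ : Function.Injective fun i => if β i ∈ A then C - β i else α i := by
    intro i j hij
    dsimp only at hij
    split_ifs at hij with h1 h2 h2
    · exact β.injective (sub_right_injective hij)
    · exact absurd (hmix i j h1 hij) h2
    · exact absurd (hmix j i h2 hij.symm) h1
    · exact α.injective hij
  refine ⟨(Equiv.swap i₀ i₁).trans (Equiv.ofBijective _ (Finite.injective_iff_bijective.1 hγ)),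
    Equiv.ofBijective _ (Finite.injective_iff_bijective.1 hβ), ?_⟩
  rintro i (rfl | hi)
  · simp only [Equiv.trans_apply, Equiv.ofBijective_apply, Equiv.swap_apply_left, hA₁, hA₀,
      if_true, if_false]
    rw [hC]
    abel
  · have h0 : i ≠ i₀ := fun e => hi₀ (e ▸ hi)
    have h1 : i ≠ i₁ := fun e => hi₁ (e ▸ hi)
    simp only [Equiv.trans_apply, Equiv.ofBijective_apply, Equiv.swap_apply_of_ne_of_ne h0 h1]
    split_ifs with hiA
    · have h2 : β (α.symm (C - F.symm (β i))) = β i := by rw [← hFa, Equiv.apply_symm_apply]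
      have h3 := β.injective h2
      rw [Equiv.symm_apply_eq, h i hi] at h3
      rw [sub_eq_iff_eq_add] at h3
      rw [h3]
      abel
    · exact h i hi

theorem exists_perm_eq_add_insert (d : G → G) (S : Set G) (α β : Equiv.Perm G)
    (h : ∀ i ∈ S, α i = β i + d i) {i₀ i₁ : G} (hi₀ : i₀ ∉ S) (hi₁ : i₁ ∉ S) (hne : i₀ ≠ i₁) :
    ∃ α' β' : Equiv.Perm G, ∀ i ∈ insert i₀ S, α' i = β' i + d i := by
  classical
  set F : Equiv.Perm G :=
    (Equiv.subLeft (β i₀ + β i₁ + d i₀)).trans (α.symm.trans β) with hF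
  rcases Equiv.Perm.exists_not_sameCycle_swap F (β.injective.ne hne) with hc | hc
  · exact exists_perm_eq_add_insert_of_not_sameCycle d S α β h hi₀ hi₁ hne hc
  · refine exists_perm_eq_add_insert_of_not_sameCycle d S ((Equiv.swap i₀ i₁).trans α) β
      (fun i hi => ?_) hi₀ hi₁ hne ?_
    · have h0 : i ≠ i₀ := fun e => hi₀ (e ▸ hi)
      have h1 : i ≠ i₁ := fun e => hi₁ (e ▸ hi)
      rw [Equiv.trans_apply, Equiv.swap_apply_of_ne_of_ne h0 h1, h i hi]
    · have hswap : (Equiv.subLeft (β i₀ + β i₁ + d i₀)).trans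
          (((Equiv.swap i₀ i₁).trans α).symm.trans β) = Equiv.swap (β i₀) (β i₁) * F := by
        ext p
        simp [hF, β.injective.map_swap]
      rwa [hswap]

/-- A theorem of Marshall Hall (1952): a function on a finite abelian group with values summing
to zero is the difference of two permutations of the group. -/
theorem exists_perm_eq_add {G : Type*} [AddCommGroup G] [Fintype G] (d : G → G)
    (hd : ∑ i, d i = 0) :
    ∃ α β : Equiv.Perm G, ∀ i, α i = β i + d i := by
  classical
  have key : ∀ S : Finset G, (∃ i₁, i₁ ∉ S) →
      ∃ α β : Equiv.Perm G, ∀ i ∈ (S : Set G), α i = β i + d i := by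
    intro S
    induction S using Finset.induction_on with
    | empty => exact fun _ => ⟨1, 1, by simp⟩
    | insert i₀ S hi₀ ih =>
      rintro ⟨i₁, hi₁⟩
      rw [Finset.mem_insert, not_or] at hi₁
      obtain ⟨α, β, h⟩ := ih ⟨i₁, hi₁.2⟩
      rw [Finset.coe_insert]
      exact exists_perm_eq_add_insert d S α β h (by simpa using hi₀) (by simpa using hi₁.2)
        (Ne.symm hi₁.1)
  obtain ⟨α, β, h⟩ := key (Finset.univ.erase 0) ⟨0, by simp⟩
  refine ⟨α, β, fun i => ?_⟩
  by_cases hi : i = 0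
  · have hsum : ∑ i, (α i - (β i + d i)) = 0 := by
      rw [Finset.sum_sub_distrib, Finset.sum_add_distrib, hd, Equiv.sum_comp α fun x => x,
        Equiv.sum_comp β fun x => x]
      simp
    rw [Fintype.sum_eq_single i fun j hj => by
      rw [h j (by simpa [← hi] using hj), sub_self]] at hsum
    exact sub_eq_zero.1 hsum
  · exact h i (by simpa using hi)

end Hall

theorem bijective_lift_add {G X : Type*} [AddCommGroup G] (N : AddSubgroup G) (R : X → G)
    (hR : Function.Bijective fun x => (R x : G ⧸ N)) (σ : X → N → N)
    (hσ : ∀ x, Function.Bijective (σ x)) :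
    Function.Bijective fun y : N × X => R y.2 + (σ y.2 y.1 : G) := by
  constructor
  · rintro ⟨k, x⟩ ⟨l, y⟩ h
    dsimp only at h
    have hxy : x = y := by
      apply hR.1
      have := congrArg (fun g : G => (g : G ⧸ N)) h
      simpa [(QuotientAddGroup.eq_zero_iff _).2 (SetLike.coe_mem _)] using this
    subst hxy
    rw [add_right_inj, SetLike.coe_eq_coe] at h
    rw [(hσ x).1 h]
  · intro g
    obtain ⟨x, hx⟩ := hR.2 g
    obtain ⟨k, hk⟩ := (hσ x).2 ⟨-R x + g, QuotientAddGroup.eq.1 hx⟩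
    exact ⟨(k, x), by simp [hk]⟩

section Sums

variable {G : Type*} [AddCommGroup G] [Fintype G]

theorem Fintype.sum_univ_id_add_self : (∑ x : G, x) + ∑ x : G, x = 0 := by
  conv_lhs => arg 2; rw [← Equiv.sum_comp (Equiv.neg G) fun x => x]
  simp [← Finset.sum_add_distrib]

theorem eq_zero_of_add_self_of_odd_card (h : Odd (Fintype.card G)) {x : G} (hx : x + x = 0) :
    x = 0 := by
  have h1 : addOrderOf x ∣ 2 := addOrderOf_dvd_of_nsmul_eq_zero (by rw [two_nsmul, hx])
  have h2 : addOrderOf x ∣ Fintype.card G := addOrderOf_dvd_card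
  have h3 := Nat.dvd_gcd h1 h2
  rw [Nat.coprime_two_left.2 h] at h3
  exact AddMonoid.addOrderOf_eq_one_iff.1 (Nat.dvd_one.1 h3)

theorem sum_univ_eq_zero_of_odd_card (h : Odd (Fintype.card G)) : ∑ x : G, x = 0 :=
  eq_zero_of_add_self_of_odd_card h Fintype.sum_univ_id_add_self

theorem sum_univ_mem_zmultiples {u : G} (hu : addOrderOf u = 2) :
    ∑ x : G, x ∈ AddSubgroup.zmultiples u := by
  classical
  set N := AddSubgroup.zmultiples u with hN
  have hb := bijective_lift_add N (fun q : G ⧸ N => q.out)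
    (by simp) (fun _ => id) fun _ => Function.bijective_id
  rw [← QuotientAddGroup.eq_zero_iff, ← hb.sum_comp fun x => x, Fintype.sum_prod_type]
  have hc : Fintype.card N = 2 := by
    rw [← Nat.card_eq_fintype_card, hN, Nat.card_zmultiples, hu]
  have h0 : ∀ k : N, ((k : G) : G ⧸ N) = 0 := fun k => (QuotientAddGroup.eq_zero_iff _).2 k.2
  simp only [← QuotientAddGroup.mk'_apply, map_sum, map_add]
  simp only [QuotientAddGroup.mk'_apply, h0, QuotientAddGroup.out_eq', id, add_zero]
  rw [Finset.sum_const, Finset.card_univ, hc, two_nsmul, Fintype.sum_univ_id_add_self]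

theorem sum_univ_eq_zero_of_ne {u v : G} (hu : addOrderOf u = 2) (hv : addOrderOf v = 2)
    (huv : u ≠ v) : ∑ x : G, x = 0 := by
  have key : ∀ {w x : G}, addOrderOf w = 2 → x ∈ AddSubgroup.zmultiples w → x = 0 ∨ x = w := by
    intro w x hw hx
    obtain ⟨k, rfl⟩ := AddSubgroup.mem_zmultiples_iff.1 hx
    have hw2 : (2 : ℤ) • w = 0 := by
      have := addOrderOf_nsmul_eq_zero w
      rw [hw] at this
      exact_mod_cast this
    rcases Int.even_or_odd' k with ⟨l, rfl | rfl⟩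
    · left
      rw [mul_comm, mul_smul, hw2, smul_zero]
    · right
      rw [add_smul, mul_comm, mul_smul, hw2, smul_zero, one_smul, zero_add]
  rcases key hu (sum_univ_mem_zmultiples hu) with h | h
  · exact h
  · rcases key hv (sum_univ_mem_zmultiples hv) with h' | h'
    · exact h'
    · exact absurd (h.symm.trans h') huv

end Sums

theorem exists_addSubgroup_card_eq.{u} (r : ℕ) : ∀ {G : Type u} [AddCommGroup G] [Finite G],
    r ∣ Nat.card G → ∃ H : AddSubgroup G, Nat.card H = r := by
  induction r using Nat.recOnMul with
  | zero => intro G _ _ h; exact absurd (Nat.eq_zero_of_zero_dvd h) Nat.card_pos.ne'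
  | one => intro G _ _ _; exact ⟨⊥, by simp⟩
  | prime l hl =>
    intro G _ _ h
    have := Fact.mk hl
    obtain ⟨x, hx⟩ := exists_prime_addOrderOf_dvd_card' l h
    exact ⟨AddSubgroup.zmultiples x, by rw [Nat.card_zmultiples, hx]⟩
  | mul r s hr hs =>
    intro G _ _ h
    obtain ⟨H, hH⟩ := hr (dvd_of_mul_right_dvd h)
    have hcard := H.card_eq_card_quotient_mul_card_addSubgroup
    have hs' : s ∣ Nat.card (G ⧸ H) := by
      rw [hcard, hH, mul_comm r] at h
      exact Nat.dvd_of_mul_dvd_mul_right (hH ▸ Nat.card_pos) h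
    obtain ⟨K, hK⟩ := hs hs'
    refine ⟨K.comap (QuotientAddGroup.mk' H), ?_⟩
    have hi := K.index_comap_of_surjective (QuotientAddGroup.mk'_surjective H)
    have h1 := (K.comap (QuotientAddGroup.mk' H)).card_mul_index
    rw [hi, hcard, ← K.card_mul_index, hK, hH] at h1
    have hpos : 0 < K.index := Nat.pos_of_ne_zero K.index_ne_zero_of_finite
    apply Nat.eq_of_mul_eq_mul_right hpos
    rw [h1]
    ring

theorem exists_zero_sum_lift {G : Type*} [AddCommGroup G] (N : AddSubgroup G)
    {I J : Type*} [Fintype I] [Fintype J] [Nonempty I] [Nonempty J] (m : I → J → G ⧸ N)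
    (hr : ∀ i, ∑ j, m i j = 0) (hc : ∀ j, ∑ i, m i j = 0) :
    ∃ R : I → J → G, (∀ i j, (R i j : G ⧸ N) = m i j) ∧
      (∀ i, ∑ j, R i j = 0) ∧ ∀ j, ∑ i, R i j = 0 := by
  classical
  obtain ⟨i₀⟩ := ‹Nonempty I›
  obtain ⟨j₀⟩ := ‹Nonempty J›
  have step : ∃ R : I → J → G, (∀ i j, (R i j : G ⧸ N) = m i j) ∧ ∀ i, ∑ j, R i j = 0 := by
    refine ⟨fun i j => (m i j).out - if j = j₀ then ∑ j', (m i j').out else 0, fun i j => ?_,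
      fun i => by simp⟩
    have h : ((∑ j', (m i j').out : G) : G ⧸ N) = 0 := by
      rw [← QuotientAddGroup.mk'_apply, map_sum]
      simpa using hr i
    dsimp only
    split_ifs <;> simp [h]
  obtain ⟨R, hRm, hR⟩ := step
  refine ⟨fun i j => R i j - if i = i₀ then ∑ i', R i' j else 0, fun i j => ?_, fun i => ?_,
    fun j => by simp⟩
  · have h : ((∑ i', R i' j : G) : G ⧸ N) = 0 := by
      rw [← QuotientAddGroup.mk'_apply, map_sum]
      simpa [hRm] using hc j
    dsimp only
    split_ifs <;> simp [h, hRm]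
  · rw [Finset.sum_sub_distrib, hR]
    split_ifs
    · rw [Finset.sum_comm]
      simp [hR]
    · simp

/-- A matrix of odd sides at least three, with zero row and column sums, whose entries are `± A`,
`± B` or `± C`. -/
theorem exists_zero_sum_matrix {E : Type*} [AddCommGroup E] (P : E → Prop)
    (hneg : ∀ x, P x → P (-x)) {A B C : E} (hA : P A) (hB : P B) (hC : P C)
    (hABC : A + B + C = 0) {p q : ℕ} (hp : Odd p) (hq : Odd q) (hp3 : 3 ≤ p) (hq3 : 3 ≤ q) :
    ∃ M : Fin p → Fin q → E, (∀ i j, P (M i j)) ∧ (∀ i, ∑ j, M i j = 0) ∧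
      ∀ j, ∑ i, M i j = 0 := by
  have step : ∀ {p q : ℕ}, 0 < p → (∃ M : Fin p → Fin q → E, (∀ i j, P (M i j)) ∧
      (∀ i, ∑ j, M i j = 0) ∧ ∀ j, ∑ i, M i j = 0) →
      ∃ M : Fin (p + 2) → Fin q → E, (∀ i j, P (M i j)) ∧ (∀ i, ∑ j, M i j = 0) ∧
        ∀ j, ∑ i, M i j = 0 := by
    rintro p q hp ⟨M, hP, hr, hc⟩
    refine ⟨Fin.cons (M ⟨0, hp⟩) (Fin.cons (-M ⟨0, hp⟩) M : Fin (p + 1) → Fin q → E), ?_, ?_, ?_⟩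
    · intro i j
      refine Fin.cases ?_ (fun i => Fin.cases ?_ (fun i => ?_) i) i
      · simpa using hP _ _
      · simpa using hneg _ (hP _ _)
      · simpa using hP _ _
    · intro i
      refine Fin.cases ?_ (fun i => Fin.cases ?_ (fun i => ?_) i) i
      · simpa using hr _
      · simpa using hr _
      · simpa using hr _
    · intro j
      simp [Fin.sum_univ_succ (n := p + 1), Fin.sum_univ_succ (n := p), hc]
  have swap : ∀ {p q : ℕ}, (∃ M : Fin p → Fin q → E, (∀ i j, P (M i j)) ∧
      (∀ i, ∑ j, M i j = 0) ∧ ∀ j, ∑ i, M i j = 0) →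
      ∃ M : Fin q → Fin p → E, (∀ i j, P (M i j)) ∧ (∀ i, ∑ j, M i j = 0) ∧
        ∀ j, ∑ i, M i j = 0 := by
    rintro p q ⟨M, hP, hr, hc⟩
    exact ⟨fun i j => M j i, fun i j => hP j i, hc, hr⟩
  have extend : ∀ {p q : ℕ}, 0 < p → (∃ M : Fin p → Fin q → E,
      (∀ i j, P (M i j)) ∧ (∀ i, ∑ j, M i j = 0) ∧ ∀ j, ∑ i, M i j = 0) → ∀ k,
      ∃ M : Fin (p + 2 * k) → Fin q → E, (∀ i j, P (M i j)) ∧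
        (∀ i, ∑ j, M i j = 0) ∧ ∀ j, ∑ i, M i j = 0 := by
    intro p q hp h k
    induction k with
    | zero => exact h
    | succ k ih => exact step (p := p + 2 * k) (by omega) ih
  have base : ∃ M : Fin 3 → Fin 3 → E, (∀ i j, P (M i j)) ∧
      (∀ i, ∑ j, M i j = 0) ∧ ∀ j, ∑ i, M i j = 0 := by
    have h1 : B + C + A = 0 := by rw [← hABC]; abel
    have h2 : C + A + B = 0 := by rw [← hABC]; abel
    refine ⟨![![A, B, C], ![B, C, A], ![C, A, B]], ?_, ?_, ?_⟩
    · intro i j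
      fin_cases i <;> fin_cases j <;> simpa
    · intro i
      fin_cases i <;> simpa [Fin.sum_univ_three]
    · intro j
      fin_cases j <;> simpa [Fin.sum_univ_three]
  obtain ⟨k, rfl⟩ : ∃ k, p = 3 + 2 * k := by
    obtain ⟨k, rfl⟩ := hp
    exact ⟨k - 1, by omega⟩
  obtain ⟨l, rfl⟩ : ∃ l, q = 3 + 2 * l := by
    obtain ⟨l, rfl⟩ := hq
    exact ⟨l - 1, by omega⟩
  exact extend (by omega) (swap (extend three_pos base l)) k

theorem exists_even_ne_zero_sum_eq_zero (p q : ℕ) [Fact p.Prime] [NeZero q] (hp : Odd p)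
    (hq3 : 3 ≤ q) :
    ∃ e : ZMod q → ZMod p, (∀ j, e (-j) = e j) ∧ (∀ j, e j ≠ 0) ∧ ∑ j, e j = 0 := by
  have hp3 : 3 ≤ p := by
    have := (Fact.out : p.Prime).two_le
    obtain ⟨k, rfl⟩ := hp
    omega
  have h2 : (2 : ZMod p) ≠ 0 := by
    intro h
    have : ((2 : ℕ) : ZMod p) = 0 := by exact_mod_cast h
    rw [ZMod.natCast_eq_zero_iff] at this
    have := Nat.le_of_dvd two_pos this
    omega
  have hfact : Fact (1 < q) := ⟨by omega⟩
  have h1 : (1 : ZMod q) ≠ 0 := one_ne_zero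
  have h11 : (1 : ZMod q) ≠ -1 := by
    intro h
    have h' : ((2 : ℕ) : ZMod q) = 0 := by
      push_cast
      linear_combination h
    rw [ZMod.natCast_eq_zero_iff] at h'
    have := Nat.le_of_dvd two_pos h'
    omega
  by_cases hpq : (q : ZMod p) = 1
  · refine ⟨fun j => 1 + (if j = 0 then 3 else 0) + (if j = 1 then -2 else 0) +
      (if j = -1 then -2 else 0), fun j => ?_, fun j => ?_, ?_⟩
    · have h3 : -j = 1 ↔ j = -1 := neg_eq_iff_eq_neg
      simp only [neg_eq_zero, h3, neg_inj]
      ring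
    · by_cases hj0 : j = 0
      · subst hj0
        have h4 : (4 : ZMod p) ≠ 0 := by
          have : (4 : ZMod p) = 2 * 2 := by norm_num
          rw [this]
          exact mul_ne_zero h2 h2
        simp only [h1.symm, if_true, if_false, zero_eq_neg, h1]
        convert h4 using 1
        norm_num
      · by_cases hj1 : j = 1
        · simp [hj1, h11]
          norm_num
        · by_cases hj2 : j = -1
          · simp [hj2, h11.symm]
            norm_num
          · simp [hj0, hj1, hj2]
    · simp only [Finset.sum_add_distrib, Finset.sum_ite_eq', Finset.mem_univ, if_true,
        Finset.sum_const, Finset.card_univ, ZMod.card, nsmul_eq_mul, hpq]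
      norm_num
  · refine ⟨fun j => 1 + if j = 0 then -(q : ZMod p) else 0, fun j => ?_, fun j => ?_, ?_⟩
    · simp
    · dsimp only
      split_ifs
      · intro h
        exact hpq (by linear_combination -h)
      · simp
    · simp [Finset.sum_add_distrib]

theorem ZMod.exists_zero_sum_table (p q : ℕ) [Fact p.Prime] [Fact q.Prime] (hp : Odd p)
    (hq : Odd q) :
    ∃ m : ZMod p → ZMod q → ZMod p × ZMod q,
      Function.Bijective (fun x : ZMod p × ZMod q => m x.1 x.2) ∧
      (∀ i, ∑ j, m i j = 0) ∧ ∀ j, ∑ i, m i j = 0 := by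
  have three_le : ∀ {r : ℕ}, r.Prime → Odd r → 3 ≤ r := by
    rintro r hr ⟨k, rfl⟩
    have := hr.two_le
    omega
  obtain ⟨e, he, he0, hes⟩ := exists_even_ne_zero_sum_eq_zero p q hp (three_le Fact.out hq)
  obtain ⟨f, -, hf0, hfs⟩ := exists_even_ne_zero_sum_eq_zero q p hq (three_le Fact.out hp)
  refine ⟨fun i j => (e j * i, f (e j * i) * j), ?_, fun i => ?_, fun j => ?_⟩
  · rw [Fintype.bijective_iff_injective_and_card]
    refine ⟨?_, rfl⟩
    rintro ⟨i, j⟩ ⟨i', j'⟩ h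
    simp only [Prod.mk.injEq] at h
    obtain ⟨h1, h2⟩ := h
    rw [h1] at h2
    obtain rfl := mul_left_cancel₀ (hf0 _) h2
    rw [mul_left_cancel₀ (he0 _) h1]
  · rw [Prod.ext_iff, Prod.fst_sum, Prod.snd_sum]
    refine ⟨by simp [← Finset.sum_mul, hes], ?_⟩
    apply eq_zero_of_add_self_of_odd_card (by rwa [ZMod.card])
    conv_lhs => arg 2; rw [← Equiv.sum_comp (Equiv.neg (ZMod q))]
    simp [he]
  · rw [Prod.ext_iff, Prod.fst_sum, Prod.snd_sum]
    have h0 : ∑ i : ZMod p, i = 0 := sum_univ_eq_zero_of_odd_card (by rwa [ZMod.card])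
    refine ⟨by rw [← Finset.mul_sum, h0, mul_zero]; rfl, ?_⟩
    have := Equiv.sum_comp (Equiv.mulLeft₀ (e j) (he0 j)) f
    simp only [Equiv.mulLeft₀_apply] at this
    simp [← Finset.sum_mul, this, hfs]

theorem exists_zero_sum_table_of_coprime {Q : Type*} [AddCommGroup Q] [Finite Q] {p q : ℕ}
    [Fact p.Prime] [Fact q.Prime] (hp : Odd p) (hq : Odd q) (hpq : p ≠ q)
    (hQ : Nat.card Q = p * q) :
    ∃ m : ZMod p → ZMod q → Q, Function.Bijective (fun x : ZMod p × ZMod q => m x.1 x.2) ∧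
      (∀ i, ∑ j, m i j = 0) ∧ ∀ j, ∑ i, m i j = 0 := by
  have hcop : p.Coprime q := (Nat.coprime_primes Fact.out Fact.out).2 hpq
  obtain ⟨u, hu⟩ := exists_prime_addOrderOf_dvd_card' (G := Q) p (hQ ▸ dvd_mul_right p q)
  obtain ⟨v, hv⟩ := exists_prime_addOrderOf_dvd_card' (G := Q) q (hQ ▸ dvd_mul_left q p)
  have hcyc : IsAddCyclic Q := isAddCyclic_of_addOrderOf_eq_card (u + v) <| by
    rw [(AddCommute.all u v).addOrderOf_add_eq_mul_addOrderOf_of_coprime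
      (by rwa [hu, hv]), hu, hv, hQ]
  obtain ⟨E⟩ : Nonempty (ZMod p × ZMod q ≃+ Q) :=
    ⟨((ZMod.chineseRemainder hcop).toAddEquiv.symm).trans
      (hQ ▸ zmodAddCyclicAddEquiv hcyc)⟩
  obtain ⟨m, hb, hr, hc⟩ := ZMod.exists_zero_sum_table p q hp hq
  exact ⟨fun i j => E (m i j), E.bijective.comp hb, fun i => by rw [← map_sum, hr, map_zero],
    fun j => by rw [← map_sum, hc, map_zero]⟩

theorem exists_zero_sum_table_of_card_sq {Q : Type*} [AddCommGroup Q] [Finite Q] {p : ℕ}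
    [Fact p.Prime] (hp : Odd p) (hQ : Nat.card Q = p * p) :
    ∃ m : ZMod p → ZMod p → Q, Function.Bijective (fun x : ZMod p × ZMod p => m x.1 x.2) ∧
      (∀ i, ∑ j, m i j = 0) ∧ ∀ j, ∑ i, m i j = 0 := by
  classical
  have := Fintype.ofFinite Q
  obtain ⟨N, hN⟩ := exists_addSubgroup_card_eq p (G := Q) (hQ ▸ dvd_mul_right p p)
  have hQN : Nat.card (Q ⧸ N) = p := by
    have := N.card_eq_card_quotient_mul_card_addSubgroup
    rw [hQ, hN] at this
    exact (Nat.eq_of_mul_eq_mul_right (Fact.out : p.Prime).pos this).symm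
  have hoddN : Odd (Fintype.card N) := by rwa [← Nat.card_eq_fintype_card, hN]
  have hoddQ : Odd (Fintype.card (Q ⧸ N)) := by rwa [← Nat.card_eq_fintype_card, hQN]
  have u : ZMod p ≃ Q ⧸ N := Fintype.equivOfCardEq (by
    rw [ZMod.card, ← Nat.card_eq_fintype_card, hQN])
  have v : ZMod p ≃ N := Fintype.equivOfCardEq (by
    rw [ZMod.card, ← Nat.card_eq_fintype_card, hN])
  have h2 : (2 : ZMod p) ≠ 0 := by
    intro h
    have h' := eq_zero_of_add_self_of_odd_card (G := ZMod p) (by rwa [ZMod.card])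
      (x := 1) (by rw [one_add_one_eq_two, h])
    exact one_ne_zero h'
  let R : Q ⧸ N → Q := fun x => x.out - (-x).out
  have hR : ∀ x, (R x : Q ⧸ N) = x + x := fun x => by simp [R]
  have hRinj : Function.Injective fun x => (R x : Q ⧸ N) := by
    intro x y h
    dsimp only at h
    rw [hR, hR] at h
    refine sub_eq_zero.1 (eq_zero_of_add_self_of_odd_card hoddQ ?_)
    rw [← sub_eq_zero] at h
    rw [← h]
    abel
  have hRsum : ∑ x, R x = 0 := by
    simp only [R, Finset.sum_sub_distrib]
    exact sub_eq_zero.2 (Equiv.sum_comp (Equiv.neg (Q ⧸ N)) fun x => x.out).symm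
  have hNsum : ∑ x : N, (x : Q) = 0 := by
    have := congrArg (fun x : N => (x : Q)) (sum_univ_eq_zero_of_odd_card hoddN)
    simpa using this
  have hsum : ∀ a b : ZMod p ≃ ZMod p, ∑ x, (R (u (a x)) + (v (b x) : Q)) = 0 := by
    intro a b
    have h1 := Equiv.sum_comp (a.trans u) R
    have h2 := Equiv.sum_comp (b.trans v) fun x : N => (x : Q)
    simp only [Equiv.trans_apply] at h1 h2
    rw [Finset.sum_add_distrib, h1, h2, hRsum, hNsum, add_zero]
  refine ⟨fun i j => R (u (i + j)) + (v (i - j) : Q), ?_,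
    fun i => hsum (Equiv.addLeft i) (Equiv.subLeft i),
    fun j => hsum (Equiv.addRight j) (Equiv.subRight j)⟩
  have hb := bijective_lift_add N R (Finite.injective_iff_bijective.1 hRinj) (fun _ => id)
    fun _ => Function.bijective_id
  have hs : Function.Bijective fun x : ZMod p × ZMod p => (v (x.1 - x.2), u (x.1 + x.2)) := by
    rw [Fintype.bijective_iff_injective_and_card]
    refine ⟨?_, by rw [Fintype.card_prod, Fintype.card_prod, Fintype.card_congr u,
      ← Fintype.card_congr v, mul_comm, Fintype.card_congr u]⟩
    rintro ⟨i, j⟩ ⟨i', j'⟩ h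
    simp only [Prod.mk.injEq, EmbeddingLike.apply_eq_iff_eq] at h
    have hi : 2 * i = 2 * i' := by linear_combination h.1 + h.2
    obtain rfl := mul_left_cancel₀ h2 hi
    rw [sub_right_inj] at h
    rw [h.1]
  exact hb.comp hs

theorem exists_zero_sum_table {Q : Type*} [AddCommGroup Q] [Finite Q] {p q : ℕ}
    [Fact p.Prime] [Fact q.Prime] (hp : Odd p) (hq : Odd q) (hQ : Nat.card Q = p * q) :
    ∃ m : ZMod p → ZMod q → Q, Function.Bijective (fun x : ZMod p × ZMod q => m x.1 x.2) ∧
      (∀ i, ∑ j, m i j = 0) ∧ ∀ j, ∑ i, m i j = 0 := by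
  rcases eq_or_ne p q with rfl | hpq
  · exact exists_zero_sum_table_of_card_sq hp hQ
  · exact exists_zero_sum_table_of_coprime hp hq hpq hQ

theorem exists_zero_sum_permutations {H : Type*} [AddCommGroup H] [Fintype H]
    (hH : ∑ x : H, x = 0) {p q : ℕ} (hp : Odd p) (hq : Odd q) (hp3 : 3 ≤ p) (hq3 : 3 ≤ q) :
    ∃ σ : Fin p → Fin q → H → H, (∀ i j, Function.Bijective (σ i j)) ∧
      (∀ i, ∑ j, σ i j = 0) ∧ ∀ j, ∑ i, σ i j = 0 := by
  obtain ⟨α, β, h⟩ := exists_perm_eq_add (fun x : H => x) hH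
  have hneg : ∀ f : H → H, Function.Bijective f → Function.Bijective (-f) := fun f hf =>
    (Equiv.neg H).bijective.comp hf
  exact exists_zero_sum_matrix (A := fun x : H => x) (B := β) (C := -α) Function.Bijective hneg
    Function.bijective_id β.bijective (hneg _ α.bijective)
    (funext fun x => by simp [h x, add_comm x]) hp hq hp3 hq3

/-- Zero-sum tables of prime sides, one for each element of a subgroup of index `p * q`. -/
theorem exists_zero_sum_tables {G : Type*} [AddCommGroup G] [Finite G] (N : AddSubgroup G)
    [Fintype N] {p q : ℕ} [Fact p.Prime] [Fact q.Prime] (hp : Odd p) (hq : Odd q)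
    (hpq : Nat.card (G ⧸ N) = p * q) (hN : ∑ x : N, x = 0) :
    ∃ y : N → Fin p → Fin q → G,
      Function.Bijective (fun x : N × Fin p × Fin q => y x.1 x.2.1 x.2.2) ∧
      (∀ k i, ∑ j, y k i j = 0) ∧ ∀ k j, ∑ i, y k i j = 0 := by
  have three_le : ∀ {r : ℕ}, r.Prime → Odd r → 3 ≤ r := by
    rintro r hr ⟨k, rfl⟩
    have := hr.two_le
    omega
  obtain ⟨m, hb, hr, hc⟩ := exists_zero_sum_table hp hq hpq
  obtain ⟨R, hRm, hRr, hRc⟩ := exists_zero_sum_lift N m hr hc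
  obtain ⟨σ, hσ, hσr, hσc⟩ := exists_zero_sum_permutations hN hp hq
    (three_le Fact.out hp) (three_le Fact.out hq)
  have u : Fin p ≃ ZMod p := Fintype.equivOfCardEq (by simp)
  have v : Fin q ≃ ZMod q := Fintype.equivOfCardEq (by simp)
  refine ⟨fun k i j => R (u i) (v j) + (σ i j k : G), ?_, fun k i => ?_, fun k j => ?_⟩
  · refine bijective_lift_add N (fun x : Fin p × Fin q => R (u x.1) (v x.2)) ?_
      (fun x => σ x.1 x.2) fun x => hσ x.1 x.2
    simp only [hRm]
    exact hb.comp (u.prodCongr v).bijective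
  · have h := congrArg (fun f : N → N => (f k : G)) (hσr i)
    simp only [Finset.sum_apply, AddSubgroup.val_finsetSum, Pi.zero_apply,
      ZeroMemClass.coe_zero] at h
    rw [Finset.sum_add_distrib, h, Equiv.sum_comp v (R (u i)), hRr, add_zero]
  · have h := congrArg (fun f : N → N => (f k : G)) (hσc j)
    simp only [Finset.sum_apply, AddSubgroup.val_finsetSum, Pi.zero_apply,
      ZeroMemClass.coe_zero] at h
    rw [Finset.sum_add_distrib, h, Equiv.sum_comp u (fun x => R x (v j)), hRc, add_zero]

/-- A family of zero-sum `p × q` tables glues to a magic rectangle set. -/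
theorem exists_isMagicRectangleSet_of_zero_sum_tables {G K : Type*} [AddCommGroup G]
    [Fintype K] {p q r s c : ℕ} (hK : Fintype.card K = r * s * c) (y : K → Fin p → Fin q → G)
    (hb : Function.Bijective (fun x : K × Fin p × Fin q => y x.1 x.2.1 x.2.2))
    (hr : ∀ k i, ∑ j, y k i j = 0) (hc : ∀ k j, ∑ i, y k i j = 0) :
    ∃ x : Fin c → Fin (p * r) → Fin (q * s) → G, IsMagicRectangleSet (p * r) (q * s) c x := by
  have e : Fin c × Fin r × Fin s ≃ K := Fintype.equivOfCardEq (by simp [hK, mul_comm])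
  let u : Fin (p * r) ≃ Fin p × Fin r := finProdFinEquiv.symm
  let v : Fin (q * s) ≃ Fin q × Fin s := finProdFinEquiv.symm
  refine ⟨fun t i j => y (e (t, (u i).2, (v j).2)) (u i).1 (v j).1, ?_, ⟨0, fun t i => ?_⟩,
    ⟨0, fun t j => ?_⟩⟩
  · refine hb.comp (f := fun z : Fin c × Fin (p * r) × Fin (q * s) =>
      (e (z.1, (u z.2.1).2, (v z.2.2).2), (u z.2.1).1, (v z.2.2).1)) ⟨?_, ?_⟩
    · rintro ⟨t, i, j⟩ ⟨t', i', j'⟩ h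
      simp only [Prod.mk.injEq, EmbeddingLike.apply_eq_iff_eq] at h
      obtain ⟨⟨h1, h2, h3⟩, h4, h5⟩ := h
      rw [h1, u.injective (Prod.ext h4 h2), v.injective (Prod.ext h5 h3)]
    · rintro ⟨k, i, j⟩
      exact ⟨((e.symm k).1, u.symm (i, (e.symm k).2.1), v.symm (j, (e.symm k).2.2)), by simp⟩
  · rw [Equiv.sum_comp v fun z => y (e (t, (u i).2, z.2)) (u i).1 z.1,
      Fintype.sum_prod_type_right]
    simp [hr]
  · rw [Equiv.sum_comp u fun z => y (e (t, z.2, (v j).2)) z.1 (v j).1,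
      Fintype.sum_prod_type_right]
    simp [hc]

theorem sum_addSubgroup_eq_zero {G : Type*} [AddCommGroup G] [Fintype G] (N : AddSubgroup G)
    [Fintype N] (hodd : Odd (Nat.card (G ⧸ N)))
    (hG : Odd (Fintype.card G) ∨ HasMoreThanOneInvolution G) : ∑ x : N, x = 0 := by
  have := Fintype.ofFinite (G ⧸ N)
  rw [Nat.card_eq_fintype_card] at hodd
  rcases hG with hG | ⟨i, j, hij, hi, hj⟩
  · refine sum_univ_eq_zero_of_odd_card (hG.of_dvd_nat ?_)
    simpa [Nat.card_eq_fintype_card] using N.card_addSubgroup_dvd_card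
  · have mem : ∀ {x : G}, addOrderOf x = 2 → x ∈ N := by
      intro x hx
      rw [← QuotientAddGroup.eq_zero_iff]
      apply eq_zero_of_add_self_of_odd_card hodd
      rw [← QuotientAddGroup.mk_add, ← two_nsmul, ← hx, addOrderOf_nsmul_eq_zero,
        QuotientAddGroup.mk_zero]
    exact sum_univ_eq_zero_of_ne (u := (⟨i, mem hi⟩ : N)) (v := ⟨j, mem hj⟩)
      (by rwa [AddSubgroup.addOrderOf_mk]) (by rwa [AddSubgroup.addOrderOf_mk]) (by simpa using hij)

theorem MRS_of_odd_prime_divisors (Γ : Type*) [AddCommGroup Γ] [Fintype Γ]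
    (a b c p₁ p₂ : ℕ) (hp₁ : p₁.Prime) (hp₂ : p₂.Prime)
    (hodd₁ : Odd p₁) (hodd₂ : Odd p₂) (hdvd₁ : p₁ ∣ a) (hdvd₂ : p₂ ∣ b)
    (hcard : Fintype.card Γ = a * b * c)
    (hΓ : Odd (Fintype.card Γ) ∨ HasMoreThanOneInvolution Γ) :
    ∃ x : Fin c → Fin a → Fin b → Γ, IsMagicRectangleSet a b c x := by
  classical
  have := Fact.mk hp₁
  have := Fact.mk hp₂
  obtain ⟨r, rfl⟩ := hdvd₁
  obtain ⟨s, rfl⟩ := hdvd₂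
  obtain ⟨N, hN⟩ := exists_addSubgroup_card_eq (r * s * c) (G := Γ)
    ⟨p₁ * p₂, by rw [Nat.card_eq_fintype_card, hcard]; ring⟩
  have hQ : Nat.card (Γ ⧸ N) = p₁ * p₂ := by
    have h := N.card_eq_card_quotient_mul_card_addSubgroup
    have hpos : 0 < r * s * c := hN ▸ Nat.card_pos
    rw [Nat.card_eq_fintype_card, hcard, hN] at h
    apply Nat.eq_of_mul_eq_mul_right hpos
    rw [← h]
    ring
  obtain ⟨y, hb, hr, hc⟩ := exists_zero_sum_tables N hodd₁ hodd₂ hQ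
    (sum_addSubgroup_eq_zero N (hQ ▸ hodd₁.mul hodd₂) hΓ)
  exact exists_isMagicRectangleSet_of_zero_sum_tables
    (by rw [← Nat.card_eq_fintype_card, hN]) y hb hr hc
end

section
/- For a, b > 1 and a finite abelian group Γ of order ab, a Γ-magic rectangle MR_Γ(a,b) exists if and only if a and b are both even, or Γ is of odd order or has more than one involution. -/
open Finset

/-- An `a × b` array containing every element of `Γ`, with constant row and column sums. -/
def MagicRect (Γ : Type*) [AddCommGroup Γ] (a b : ℕ) : Prop :=
  ∃ x : Fin a → Fin b → Γ, (∀ g, ∃ i j, x i j = g) ∧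
    (∃ ω, ∀ i, ∑ j, x i j = ω) ∧ ∃ δ, ∀ j, ∑ i, x i j = δ

namespace MagicRect

theorem of_fintype {Γ ι κ : Type*} [AddCommGroup Γ] [Fintype ι] [Fintype κ] {a b : ℕ}
    (hι : Fintype.card ι = a) (hκ : Fintype.card κ = b) (x : ι → κ → Γ)
    (hx : ∀ g, ∃ i j, x i j = g) (ω δ : Γ) (hr : ∀ i, ∑ j, x i j = ω)
    (hc : ∀ j, ∑ i, x i j = δ) : MagicRect Γ a b := by
  let e := Fintype.equivFinOfCardEq hι
  let f := Fintype.equivFinOfCardEq hκ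
  refine ⟨fun i j => x (e.symm i) (f.symm j), fun g => ?_, ⟨ω, fun i => ?_⟩, ⟨δ, fun j => ?_⟩⟩
  · obtain ⟨i, j, h⟩ := hx g
    exact ⟨e i, f j, by simpa using h⟩
  · rw [← hr (e.symm i)]
    exact Equiv.sum_comp f.symm fun j => x (e.symm i) j
  · rw [← hc (f.symm j)]
    exact Equiv.sum_comp e.symm fun i => x i (f.symm j)

theorem swap {Γ : Type*} [AddCommGroup Γ] {a b : ℕ} (h : MagicRect Γ a b) : MagicRect Γ b a := by
  obtain ⟨x, hx, hr, hc⟩ := h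
  exact ⟨fun i j => x j i, fun g => (hx g).elim fun i ⟨j, h⟩ => ⟨j, i, h⟩, hc, hr⟩

theorem map {Γ Δ : Type*} [AddCommGroup Γ] [AddCommGroup Δ] {a b : ℕ} (e : Γ ≃+ Δ)
    (h : MagicRect Γ a b) : MagicRect Δ a b := by
  obtain ⟨x, hx, ⟨ω, hr⟩, ⟨δ, hc⟩⟩ := h
  refine ⟨fun i j => e (x i j), fun g => ?_, ⟨e ω, fun i => ?_⟩, ⟨e δ, fun j => ?_⟩⟩
  · obtain ⟨i, j, h⟩ := hx (e.symm g)
    exact ⟨i, j, by simp [h]⟩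
  · rw [← map_sum, hr]
  · rw [← map_sum, hc]

/-- If `R` is a family of coset representatives of `H` with sum zero, permuted column by column
so that each row of representatives has sum zero, then a magic rectangle on `H` can be extended. -/
theorem extend {Γ K : Type*} [AddCommGroup Γ] [Fintype K] {a b : ℕ} {H : AddSubgroup Γ}
    (h : MagicRect H a b) (R : K → Γ) (hR : ∀ g, ∃ k, g - R k ∈ H) (π : Fin b → K ≃ K)
    (hrow : ∀ k, ∑ j, R (π j k) = 0) (hcol : ∑ k, R k = 0) :
    MagicRect Γ (Fintype.card K * a) b := by
  obtain ⟨x, hx, ⟨ω, hr⟩, ⟨δ, hc⟩⟩ := h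
  refine of_fintype (ι := K × Fin a) (κ := Fin b) (by simp) (by simp)
    (fun ki j => x ki.2 j + R (π j ki.1)) (fun g => ?_) ω (Fintype.card K • (δ : Γ))
    (fun i => ?_) fun j => ?_
  · obtain ⟨k, hk⟩ := hR g
    obtain ⟨i, j, hij⟩ := hx ⟨_, hk⟩
    exact ⟨((π j).symm k, i), j, by simp [hij]⟩
  · rw [sum_add_distrib, hrow, add_zero, ← hr i.2]
    simp
  · rw [sum_add_distrib, Fintype.sum_prod_type, Fintype.sum_prod_type_right]
    simp only [Equiv.sum_comp (π j) R, hcol, sum_const_zero, add_zero, ← hc j]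
    simp

end MagicRect

/-- Columns of types `0, 1, 2` cancel in triples and columns of types `0, 3` cancel in pairs. -/
theorem exists_columnType : ∀ n : ℕ, 2 ≤ n → ∃ c : Fin n → Fin 4,
    ∀ {A : Type*} [AddCommGroup A] (f : Fin 4 → A), f 0 + f 1 + f 2 = 0 → f 0 + f 3 = 0 →
      ∑ j, f (c j) = 0
  | 0, h | 1, h => by omega
  | 2, _ => ⟨![0, 3], fun f _ h => by simpa [Fin.sum_univ_two] using h⟩
  | 3, _ => ⟨![0, 1, 2], fun f h _ => by simpa [Fin.sum_univ_three] using h⟩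
  | n + 4, _ => by
    obtain ⟨c, hc⟩ := exists_columnType (n + 2) (by omega)
    refine ⟨Fin.cons 0 (Fin.cons 3 c), fun f h h' => ?_⟩
    rw [Fin.sum_univ_succ, Fin.sum_univ_succ]
    simp [hc f h h', h']

/-- The second and third rows of a Kotzig array, together with the identity and its complement. -/
def kotzig (P : ℕ) (f : Fin 4) (k : Fin (2 * P + 1)) : Fin (2 * P + 1) :=
  match f with
  | 0 => k
  | 1 => if hk : k.1 % 2 = 0 then ⟨2 * P - k / 2, by omega⟩ else ⟨P - 1 - k / 2, by omega⟩
  | 2 => if hk : k.1 % 2 = 0 then ⟨P - k / 2, by omega⟩ else ⟨2 * P - k / 2, by omega⟩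
  | 3 => ⟨2 * P - k, by omega⟩

theorem kotzig_injective (P : ℕ) (f : Fin 4) : Function.Injective (kotzig P f) := by
  intro k l h
  fin_cases f <;> simp only [kotzig] at h
  · exact h
  · split_ifs at h <;> simp only [Fin.ext_iff] at h ⊢ <;> omega
  · split_ifs at h <;> simp only [Fin.ext_iff] at h ⊢ <;> omega
  · simp only [Fin.ext_iff] at h ⊢
    omega

theorem kotzig_sum_three (P : ℕ) (k : Fin (2 * P + 1)) :
    (kotzig P 0 k : ℕ) + kotzig P 1 k + kotzig P 2 k = 3 * P := by
  simp only [kotzig]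
  split_ifs <;> simp only <;> omega

theorem kotzig_sum_two (P : ℕ) (k : Fin (2 * P + 1)) :
    (kotzig P 0 k : ℕ) + kotzig P 3 k = 2 * P := by
  simp only [kotzig]
  omega

theorem sum_fin_sub (P : ℕ) : ∑ k : Fin (2 * P + 1), ((k : ℤ) - P) = 0 := by
  have h : ∑ k : Fin (2 * P + 1), ((k : ℤ) - P) = ∑ k : Fin (2 * P + 1), -((k : ℤ) - P) := by
    refine Fintype.sum_equiv Fin.revPerm _ _ fun k => ?_
    simp only [Fin.revPerm_apply, Fin.val_rev]
    omega
  rw [sum_neg_distrib] at h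
  omega

theorem card_comap_mk' {Γ : Type*} [AddCommGroup Γ] [Finite Γ] (N : AddSubgroup Γ)
    (H : AddSubgroup (Γ ⧸ N)) :
    Nat.card (H.comap (QuotientAddGroup.mk' N)) = Nat.card H * Nat.card N := by
  have h1 := H.index_comap_of_surjective (QuotientAddGroup.mk'_surjective N)
  have h2 := (H.comap (QuotientAddGroup.mk' N)).card_mul_index
  have h3 := H.card_mul_index
  have h4 := AddSubgroup.card_eq_card_quotient_mul_card_addSubgroup N
  have h5 : 0 < H.index := Nat.pos_of_ne_zero H.index_ne_zero_of_finite
  rw [h1, h4, ← h3] at h2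
  refine Nat.eq_of_mul_eq_mul_right h5 (h2.trans ?_)
  ring

theorem exists_addSubgroup_card {Γ : Type*} [AddCommGroup Γ] [Finite Γ] {d : ℕ}
    (hd : d ∣ Nat.card Γ) : ∃ H : AddSubgroup Γ, Nat.card H = d := by
  induction h : Nat.card Γ using Nat.strong_induction_on generalizing Γ d with
  | _ n ih =>
    obtain rfl | hd1 := eq_or_ne d 1
    · exact ⟨⊥, by simp⟩
    have hp := Nat.minFac_prime hd1
    have : Fact d.minFac.Prime := ⟨hp⟩
    obtain ⟨x, hx⟩ := exists_prime_addOrderOf_dvd_card' d.minFac ((Nat.minFac_dvd d).trans hd)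
    have hN : Nat.card (AddSubgroup.zmultiples x) = d.minFac := by rw [Nat.card_zmultiples, hx]
    have hcard :=
      AddSubgroup.card_eq_card_quotient_mul_card_addSubgroup (AddSubgroup.zmultiples x)
    have hpos : 0 < Nat.card (Γ ⧸ AddSubgroup.zmultiples x) := Nat.card_pos
    rw [hN] at hcard
    obtain ⟨e, he⟩ := Nat.minFac_dvd d
    have hlt : Nat.card (Γ ⧸ AddSubgroup.zmultiples x) < n := by
      rw [← h, hcard]
      nlinarith [hp.two_le]
    have hdvd : e * d.minFac ∣ Nat.card (Γ ⧸ AddSubgroup.zmultiples x) * d.minFac := by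
      rwa [← hcard, Nat.mul_comm, ← he]
    obtain ⟨H, hH⟩ := ih _ hlt (Nat.dvd_of_mul_dvd_mul_right hp.pos hdvd) rfl
    refine ⟨H.comap (QuotientAddGroup.mk' _), ?_⟩
    rw [card_comap_mk', hH, hN, Nat.mul_comm, ← he]

theorem exists_le_addSubgroup_card {Γ : Type*} [AddCommGroup Γ] [Finite Γ] (D : AddSubgroup Γ)
    {d : ℕ} (hd : d * Nat.card D ∣ Nat.card Γ) :
    ∃ H : AddSubgroup Γ, D ≤ H ∧ Nat.card H = d * Nat.card D := by
  rw [AddSubgroup.card_eq_card_quotient_mul_card_addSubgroup D] at hd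
  obtain ⟨H, hH⟩ := exists_addSubgroup_card (Nat.dvd_of_mul_dvd_mul_right Nat.card_pos hd)
  refine ⟨H.comap (QuotientAddGroup.mk' D), fun x hx => ?_, by rw [card_comap_mk', hH]⟩
  simp [(QuotientAddGroup.eq_zero_iff x).2 hx]

/-- A finite abelian group is the product of two subgroups of coprime orders. -/
theorem exists_prod_addEquiv {Γ : Type*} [AddCommGroup Γ] [Finite Γ] {m n : ℕ}
    (hcard : Nat.card Γ = m * n) (hmn : m.Coprime n) :
    ∃ A B : AddSubgroup Γ, Nat.card A = m ∧ Nat.card B = n ∧ Nonempty (A × B ≃+ Γ) := by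
  obtain ⟨A, hA⟩ := exists_addSubgroup_card (Dvd.intro n hcard.symm)
  obtain ⟨B, hB⟩ := exists_addSubgroup_card (Dvd.intro_left m hcard.symm)
  have hAB : Disjoint A B := AddSubgroup.disjoint_of_coprime_natCard (by rwa [hA, hB])
  refine ⟨A, B, hA, hB, ⟨AddEquiv.ofBijective (A.subtype.coprod B.subtype) ?_⟩⟩
  refine (Nat.bijective_iff_injective_and_card _).2 ⟨?_, by simp [hA, hB, hcard]⟩
  rw [injective_iff_map_eq_zero]
  rintro ⟨x, y⟩ hxy
  simp only [AddMonoidHom.coprod_apply, AddSubgroup.coe_subtype] at hxy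
  have hx : (x : Γ) = 0 := by
    refine AddSubgroup.disjoint_def.1 hAB x.2 ?_
    rw [eq_neg_of_add_eq_zero_left hxy]
    exact B.neg_mem y.2
  rw [hx, zero_add] at hxy
  ext <;> simp [hx, hxy]

/-- Extension along a subgroup of odd prime index. -/
theorem MagicRect.extend_of_index_odd_prime {Γ : Type*} [AddCommGroup Γ] [Finite Γ] {a b q : ℕ}
    (hq : q.Prime) (hq2 : Odd q) (hb : 2 ≤ b) {H : AddSubgroup Γ}
    (hH : Nat.card Γ = q * Nat.card H) (h : MagicRect H a b) : MagicRect Γ (q * a) b := by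
  obtain ⟨P, rfl⟩ := hq2
  obtain ⟨c, hc⟩ := exists_columnType b hb
  have hindex : Nat.card (Γ ⧸ H) = 2 * P + 1 := by
    refine Nat.eq_of_mul_eq_mul_right (Nat.card_pos (α := H)) ?_
    rw [← hH, AddSubgroup.card_eq_card_quotient_mul_card_addSubgroup H]
  have : Fact (2 * P + 1).Prime := ⟨hq⟩
  obtain ⟨t, ht⟩ : ∃ t : Γ ⧸ H, t ≠ 0 := by
    have : Nontrivial (Γ ⧸ H) := Finite.one_lt_card_iff_nontrivial.1 (hindex ▸ hq.one_lt)
    exact exists_ne 0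
  obtain ⟨t, rfl⟩ := QuotientAddGroup.mk_surjective t
  have key := h.extend (K := Fin (2 * P + 1)) (fun k => ((k : ℤ) - P) • t) (fun g => ?_)
    (fun j => Equiv.ofBijective _ (Finite.injective_iff_bijective.1 (kotzig_injective P (c j))))
    (fun k => ?_) ?_
  · simpa using key
  · have hg := mem_zmultiples_of_prime_card hindex ht (g' := (g + (P : ℤ) • t : Γ))
    obtain ⟨k, hk⟩ := AddSubgroup.mem_zmultiples_iff.1 hg
    have hkt : g + (P : ℤ) • t - k • t ∈ H := by
      rw [← QuotientAddGroup.eq_zero_iff, QuotientAddGroup.mk_sub, ← hk, QuotientAddGroup.mk_zsmul,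
        sub_self]
    have hmt : ((2 * P + 1 : ℕ) : ℤ) • t ∈ H := by
      rw [← QuotientAddGroup.eq_zero_iff, QuotientAddGroup.mk_zsmul, natCast_zsmul, ← hindex,
        card_nsmul_eq_zero']
    have hpos : (0 : ℤ) < (2 * P + 1 : ℕ) := by omega
    have h0 := Int.emod_nonneg k hpos.ne'
    have h1 := Int.emod_lt_of_pos k hpos
    have h2 := Int.mul_ediv_add_emod k (2 * P + 1 : ℕ)
    refine ⟨⟨(k % (2 * P + 1 : ℕ)).toNat, by omega⟩, ?_⟩
    convert H.add_mem hkt (H.zsmul_mem hmt (k / (2 * P + 1 : ℕ))) using 1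
    rw [Int.toNat_of_nonneg h0, eq_sub_of_add_eq' h2]
    module
  · simp only [Equiv.ofBijective_apply]
    refine hc (fun f => (((kotzig P f k : ℕ) : ℤ) - P) • t) ?_ ?_
    · rw [← add_smul, ← add_smul]
      have := kotzig_sum_three P k
      rw [show (((kotzig P 0 k : ℕ) : ℤ) - P) + (((kotzig P 1 k : ℕ) : ℤ) - P) +
        (((kotzig P 2 k : ℕ) : ℤ) - P) = 0 by omega, zero_smul]
    · rw [← add_smul]
      have := kotzig_sum_two P k
      rw [show (((kotzig P 0 k : ℕ) : ℤ) - P) + (((kotzig P 3 k : ℕ) : ℤ) - P) = 0 by omega,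
        zero_smul]
  · rw [← sum_smul, sum_fin_sub, zero_smul]

theorem eq_zero_of_add_self_eq_zero {B : Type*} [AddCommGroup B] [Finite B]
    (hB : Odd (Nat.card B)) {x : B} (hx : x + x = 0) : x = 0 := by
  have h2 : addOrderOf x ∣ 2 := addOrderOf_dvd_of_nsmul_eq_zero (by rw [two_nsmul, hx])
  have h := Nat.dvd_gcd (addOrderOf_dvd_natCard x) h2
  rw [Nat.coprime_two_right.2 hB, Nat.dvd_one] at h
  exact AddMonoid.addOrderOf_eq_one_iff.1 h

theorem neg_ne_self_of_odd_card {B : Type*} [AddCommGroup B] [Finite B]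
    (hB : Odd (Nat.card B)) {x : B} (hx : x ≠ 0) : -x ≠ x := fun h =>
  hx (eq_zero_of_add_self_eq_zero hB (by nth_rw 1 [← h]; simp))

theorem sum_eq_zero_of_odd_function {B : Type*} [AddCommGroup B] [Fintype B]
    (hB : Odd (Nat.card B)) {f : B → B} (hf : ∀ x, f (-x) = -f x) :
    ∑ x, f x = 0 := by
  refine eq_zero_of_add_self_eq_zero hB ?_
  nth_rw 2 [← Equiv.sum_comp (Equiv.neg B)]
  simp [hf]

theorem exists_odd_sign {B : Type*} [AddCommGroup B] [Finite B] :
    ∃ s : B → ℤ, (∀ x, s x = 1 ∨ s x = -1) ∧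
    ∀ x, -x ≠ x → s (-x) = -s x := by
  let e := Finite.equivFin B
  refine ⟨fun x => if e x < e (-x) then 1 else -1, fun x => ?_, fun x hx => ?_⟩
  · simp only
    split_ifs <;> simp
  · have : e x ≠ e (-x) := fun h => hx (e.injective h).symm
    simp only [neg_neg]
    split_ifs <;> first | rfl | omega

theorem exists_symmetric_finset {B : Type*} [AddCommGroup B] [Fintype B]
    (hB : Odd (Nat.card B)) (k : ℕ) (hk : 2 * k + 1 ≤ Fintype.card B) :
    ∃ S : Finset B, (∀ x, -x ∈ S ↔ x ∈ S) ∧ 0 ∉ S ∧ #S = 2 * k := by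
  classical
  induction k with
  | zero => exact ⟨∅, by simp⟩
  | succ k ih =>
    obtain ⟨S, hS, h0, hc⟩ := ih (by omega)
    obtain ⟨x, hx⟩ : ∃ x, x ∉ insert 0 S := by
      by_contra! h
      have := card_le_card (fun x _ => h x : (univ : Finset B) ⊆ insert 0 S)
      rw [card_insert_of_notMem h0, card_univ] at this
      omega
    rw [mem_insert, not_or] at hx
    have hx' := neg_ne_self_of_odd_card hB hx.1
    refine ⟨insert x (insert (-x) S), fun y => ?_, ?_, ?_⟩
    · simp only [mem_insert, hS, neg_eq_iff_eq_neg, neg_neg]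
      tauto
    · simp [Ne.symm hx.1, h0, (neg_ne_zero.2 hx.1).symm]
    · rw [card_insert_of_notMem, card_insert_of_notMem, hc]
      · ring
      · rw [hS]
        exact hx.2
      · simp [hx'.symm, hx.2]

theorem exists_even_sign {B : Type*} [AddCommGroup B] [Fintype B]
    (hB : Odd (Nat.card B)) {n : ℕ} (hn : Odd n) (hle : n ≤ Nat.card B) :
    ∃ s : B → ℤ, (∀ x, s x = 1 ∨ s x = -1) ∧ (∀ x, s (-x) = s x) ∧ ∑ x, s x = n := by
  classical
  rw [Nat.card_eq_fintype_card] at hle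
  obtain ⟨M, hM, hc⟩ : ∃ M : Finset B, (∀ x, -x ∈ M ↔ x ∈ M) ∧ 2 * #M + n = Fintype.card B := by
    have hB' := hB
    rw [Nat.card_eq_fintype_card] at hB'
    obtain ⟨l, hl⟩ := hB'
    obtain ⟨r, rfl⟩ := hn
    obtain ⟨k, hk⟩ | ⟨k, hk⟩ := Nat.even_or_odd (l - r)
    · obtain ⟨S, hS, -, hc⟩ := exists_symmetric_finset hB k (by omega)
      exact ⟨S, hS, by omega⟩
    · obtain ⟨S, hS, h0, hc⟩ := exists_symmetric_finset hB k (by omega)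
      exact ⟨insert 0 S, by simp [hS], by rw [card_insert_of_notMem h0]; omega⟩
  refine ⟨fun x => if x ∈ M then -1 else 1, fun x => ?_, fun x => by simp [hM], ?_⟩
  · simp only
    split_ifs <;> simp
  · have h := card_compl_add_card M
    rw [sum_ite]
    simp only [sum_const, filter_mem_eq_inter, univ_inter, filter_notMem_eq_sdiff,
      ← compl_eq_univ_sdiff, nsmul_eq_mul]
    omega

theorem MagicRect.prod_of_odd {A B : Type*} [AddCommGroup A] [AddCommGroup B] [Finite A] [Finite B]
    (hA : Odd (Nat.card A)) (hB : Odd (Nat.card B)) (h1 : 1 < Nat.card A)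
    (hle : Nat.card A ≤ Nat.card B) : MagicRect (A × B) (Nat.card A) (Nat.card B) := by
  classical
  have := Fintype.ofFinite A
  have := Fintype.ofFinite B
  obtain ⟨s, hs, hneg, hsum⟩ := exists_even_sign hB hA hle
  obtain ⟨g, hg, hgneg⟩ := exists_odd_sign (B := A)
  have : Nontrivial A := Finite.one_lt_card_iff_nontrivial.1 h1
  obtain ⟨e, he⟩ := exists_ne (0 : A)
  have hee := neg_ne_self_of_odd_card hA he
  have hss : ∀ x, s x * s x = 1 := fun x => by rcases hs x with h | h <;> simp [h]
  have hgg : ∀ x, g x * g x = 1 := fun x => by rcases hg x with h | h <;> simp [h]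
  have hs2 : ∀ i x, s (s i • x) = s x := fun i x => by rcases hs i with h | h <;> simp [h, hneg]
  have hg2 : ∀ i x, s (g i • x) = s x := fun i x => by rcases hg i with h | h <;> simp [h, hneg]
  let u : A → B → ℤ := fun i j => if i = 0 ∨ i = e ∨ i = -e then 0 else g i * s j
  let v : A → B → ℤ := fun i j => (if i = 0 then -2 else 0) + (if i = e then 1 else 0) +
    (if i = -e then 1 else 0) + u i j
  have hv0 (j) : v 0 j = -2 := by simp [v, u, he.symm, (neg_ne_zero.2 he).symm]
  have hve (j) : v e j = 1 := by simp [v, u, he, hee.symm]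
  have hve' (j) : v (-e) j = 1 := by simp [v, u, he, hee]
  have hv (i j) (hi : ¬ (i = 0 ∨ i = e ∨ i = -e)) : v i j = g i * s j := by
    have := not_or.1 hi
    simp_all [v, u]
  refine of_fintype Nat.card_eq_fintype_card.symm Nat.card_eq_fintype_card.symm
    (fun i j => (s j • i, v i j • j)) ?_ 0 0 (fun i => Prod.ext ?_ ?_) fun j => Prod.ext ?_ ?_
  · rintro ⟨x, w⟩
    by_cases hx : x = 0 ∨ x = e ∨ x = -e
    · rcases hx with rfl | hx
      · obtain ⟨y, hy⟩ : ∃ y : B, y + y = w := by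
          have : Function.Injective fun y : B => y + y := fun y z h => by
            refine sub_eq_zero.1 (eq_zero_of_add_self_eq_zero hB ?_)
            have h : y + y = z + z := h
            rw [sub_add_sub_comm, h, sub_self]
          exact Finite.surjective_of_injective this w
        exact ⟨0, -y, by simp [hv0, ← hy, two_zsmul]⟩
      · refine ⟨s w • x, w, ?_⟩
        have : v (s w • x) w = 1 := by
          rcases hs w with h | h <;> rcases hx with rfl | rfl <;> simp [h, hve, hve']
        simp [this, smul_smul, hss]
    · let i := fun w => s w • x
      have hi (w) : ¬ (i w = 0 ∨ i w = e ∨ i w = -e) := by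
        rcases hs w with h | h <;> simp only [i, h, one_smul, neg_smul, neg_eq_zero, neg_inj]
        · exact hx
        · rw [neg_eq_iff_eq_neg]
          tauto
      refine ⟨i w, (g (i w) * s w) • w, ?_⟩
      have : s ((g (i w) * s w) • w) = s w := by rw [mul_smul, hg2, hs2]
      rw [hv _ _ (hi w), this, smul_smul, smul_smul]
      congr 1
      · rw [hss, one_smul]
      · rw [show g (i w) * s w * (g (i w) * s w) = (g (i w) * g (i w)) * (s w * s w) by ring, hss,
          hgg, one_mul, one_smul]
  · simp only [Prod.fst_sum, Prod.fst_zero]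
    rw [← sum_smul, hsum, natCast_zsmul, card_nsmul_eq_zero']
  · simp only [Prod.snd_sum, Prod.snd_zero]
    refine sum_eq_zero_of_odd_function hB fun x => ?_
    simp [v, u, hneg]
  · simp only [Prod.fst_sum, Prod.fst_zero]
    exact sum_eq_zero_of_odd_function hA fun x => smul_neg _ _
  · simp only [Prod.snd_sum, Prod.snd_zero]
    rw [← sum_smul]
    have hu : ∑ i, u i j = 0 := by
      have h : ∑ i, u i j = ∑ i, -u i j := by
        rw [← Equiv.sum_comp (Equiv.neg A)]
        refine sum_congr rfl fun i _ => ?_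
        simp only [Equiv.neg_apply, u, neg_eq_zero, neg_inj]
        by_cases hi : i = 0 ∨ i = e ∨ i = -e
        · rw [if_pos hi, if_pos, neg_zero]
          rw [neg_eq_iff_eq_neg]
          tauto
        · rw [if_neg hi, if_neg, hgneg, neg_mul]
          · exact neg_ne_self_of_odd_card hA fun h => hi (Or.inl h)
          · rw [neg_eq_iff_eq_neg]
            tauto
      rw [sum_neg_distrib] at h
      omega
    simp [v, sum_add_distrib, hu]

theorem MagicRect.of_card_prime_sq {Γ : Type*} [AddCommGroup Γ] [Finite Γ] {p : ℕ}
    (hp : p.Prime) (hp2 : Odd p) (hcard : Nat.card Γ = p * p) : MagicRect Γ p p := by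
  have : Fact p.Prime := ⟨hp⟩
  have hodd : Odd (Nat.card (ZMod p)) := by simpa
  obtain ⟨H, hH⟩ := exists_addSubgroup_card (Dvd.intro p hcard.symm)
  have hindex : Nat.card (Γ ⧸ H) = p := by
    refine Nat.eq_of_mul_eq_mul_right (Nat.card_pos (α := H)) ?_
    rw [← AddSubgroup.card_eq_card_quotient_mul_card_addSubgroup H, hcard, hH]
  obtain ⟨g, hg⟩ : ∃ g : H, g ≠ 0 := by
    have : Nontrivial H := Finite.one_lt_card_iff_nontrivial.1 (hH ▸ hp.one_lt)
    exact exists_ne 0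
  obtain ⟨t, ht⟩ : ∃ t : Γ ⧸ H, t ≠ 0 := by
    have : Nontrivial (Γ ⧸ H) := Finite.one_lt_card_iff_nontrivial.1 (hindex ▸ hp.one_lt)
    exact exists_ne 0
  obtain ⟨t, rfl⟩ := QuotientAddGroup.mk_surjective t
  have key {G : Type _} [AddCommGroup G] (hG : Nat.card G = p) {x : G} (hx : x ≠ 0) (y : G) :
      ∃ k : ZMod p, k.valMinAbs • x = y := by
    obtain ⟨k, hk⟩ := AddSubgroup.mem_zmultiples_iff.1 (mem_zmultiples_of_prime_card hG hx (g' := y))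
    refine ⟨k, ?_⟩
    rw [← hk, ← sub_eq_zero, ← sub_smul]
    obtain ⟨l, hl⟩ := (ZMod.intCast_eq_intCast_iff_dvd_sub k (k : ZMod p).valMinAbs p).1 (by simp)
    rw [hl, mul_comm, mul_smul, natCast_zsmul, ← hG, card_nsmul_eq_zero', smul_zero]
  have hsum : ∑ k : ZMod p, k.valMinAbs = 0 := by
    have h : ∑ k : ZMod p, k.valMinAbs = ∑ k : ZMod p, -k.valMinAbs := by
      rw [← Equiv.sum_comp (Equiv.neg _)]
      refine sum_congr rfl fun k _ => ZMod.valMinAbs_neg_of_ne_half fun h => ?_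
      obtain ⟨r, hr⟩ := hp2
      omega
    rw [sum_neg_distrib] at h
    omega
  refine of_fintype (ZMod.card p) (ZMod.card p)
    (fun i j : ZMod p => (i + j).valMinAbs • (g : Γ) + (i - j).valMinAbs • t) (fun x => ?_) 0 0
    (fun i => ?_) fun j => ?_
  · obtain ⟨l, hl⟩ := key hindex ht x
    have hmem : x - l.valMinAbs • t ∈ H := by
      rw [← QuotientAddGroup.eq_zero_iff, QuotientAddGroup.mk_sub, ← hl, QuotientAddGroup.mk_zsmul,
        sub_self]
    obtain ⟨k, hk⟩ := key hH hg ⟨_, hmem⟩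
    have h2 : (2 : ZMod p) ≠ 0 := fun h => by
      have h := (ZMod.natCast_eq_zero_iff 2 p).1 (by exact_mod_cast h)
      rw [(Nat.prime_dvd_prime_iff_eq hp Nat.prime_two).1 h] at hp2
      exact absurd hp2 (by decide)
    refine ⟨(k + l) / 2, (k - l) / 2, ?_⟩
    rw [show (k + l) / 2 + (k - l) / 2 = k by field_simp; ring,
      show (k + l) / 2 - (k - l) / 2 = l by field_simp; ring]
    have := congrArg Subtype.val hk
    simp only [AddSubgroup.coe_zsmul] at this
    rw [this, sub_add_cancel]
  · have h₁ : ∑ j, (i + j).valMinAbs = 0 := (Equiv.sum_comp (Equiv.addLeft i) _).trans hsum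
    have h₂ : ∑ j, (i - j).valMinAbs = 0 := (Equiv.sum_comp (Equiv.subLeft i) _).trans hsum
    simp [sum_add_distrib, ← sum_smul, h₁, h₂]
  · have h₁ : ∑ i, (i + j).valMinAbs = 0 := (Equiv.sum_comp (Equiv.addRight j) _).trans hsum
    have h₂ : ∑ i, (i - j).valMinAbs = 0 := (Equiv.sum_comp (Equiv.subRight j) _).trans hsum
    simp [sum_add_distrib, ← sum_smul, h₁, h₂]

theorem MagicRect.of_odd {Γ : Type*} [AddCommGroup Γ] [Finite Γ] {a b : ℕ} (ha : 1 < a)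
    (hb : 1 < b) (hcard : Nat.card Γ = a * b) (hodd : Odd (Nat.card Γ)) : MagicRect Γ a b := by
  induction hn : Nat.card Γ using Nat.strong_induction_on generalizing Γ a b with
  | _ n ih =>
    have main : ∀ {a b : ℕ}, 1 < a → 1 < b → Nat.card Γ = a * b → ¬ a.Prime → MagicRect Γ a b := by
      intro a b ha hb hcard hap
      have hq := Nat.minFac_prime ha.ne'
      obtain ⟨d, hd⟩ := Nat.minFac_dvd a
      have hda : Nat.card Γ = a.minFac * (d * b) := by rw [hcard, ← mul_assoc, ← hd]
      obtain ⟨H, hH⟩ := exists_addSubgroup_card (Dvd.intro_left _ hda.symm)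
      have hd1 : 1 < d := by
        rcases d with _ | _ | d
        · omega
        · rw [zero_add, mul_one] at hd
          exact absurd (hd ▸ hq) hap
        · omega
      rw [hd]
      rw [hda, Nat.odd_mul] at hodd
      refine extend_of_index_odd_prime hq hodd.1 hb (H := H) (by rw [hda, hH])
        (ih (Nat.card H) ?_ hd1 hb hH (hH ▸ hodd.2) rfl)
      rw [hH, ← hn, hda]
      nlinarith [hq.two_le, Nat.mul_pos (by omega : 0 < d) (by omega : 0 < b)]
    by_cases hap : a.Prime
    swap
    · exact main ha hb hcard hap
    by_cases hbp : b.Prime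
    swap
    · exact (main hb ha (by rw [hcard, mul_comm]) hbp).swap
    obtain rfl | hab := eq_or_ne a b
    · exact of_card_prime_sq hap (Nat.odd_mul.1 (hcard ▸ hodd)).1 hcard
    have main' : ∀ {a b : ℕ}, 1 < a → Nat.card Γ = a * b → a.Coprime b → a ≤ b →
        MagicRect Γ a b := by
      intro a b ha hcard hab hle
      rw [hcard, Nat.odd_mul] at hodd
      obtain ⟨A, B, rfl, rfl, ⟨e⟩⟩ := exists_prod_addEquiv hcard hab
      exact (prod_of_odd hodd.1 hodd.2 ha hle).map e
    have hcop := (Nat.coprime_primes hap hbp).2 hab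
    obtain h | h := le_total a b
    · exact main' ha hcard hcop h
    · exact (main' hb (by rw [hcard, mul_comm]) hcop.symm h).swap

theorem exists_involution {Γ : Type*} [AddCommGroup Γ] [Finite Γ] (h : 2 ∣ Nat.card Γ) :
    ∃ x : Γ, x ≠ 0 ∧ x + x = 0 := by
  obtain ⟨x, hx⟩ := exists_prime_addOrderOf_dvd_card' 2 h
  refine ⟨x, fun h0 => by simp [h0] at hx, ?_⟩
  rw [← two_nsmul, ← hx, addOrderOf_nsmul_eq_zero]

theorem exists_involution_not_double {Γ : Type*} [AddCommGroup Γ] [Finite Γ]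
    (h : 4 ∣ Nat.card Γ) : ∃ ι c : Γ, ι ≠ 0 ∧ ι + ι = 0 ∧ (∀ x, x + x ≠ c) ∧
      ∀ x, x + x ≠ c + ι := by
  obtain ⟨ι, hι, hι2⟩ := exists_involution ((by norm_num : 2 ∣ 4).trans h)
  by_cases hex : ∃ y : Γ, y + y ≠ 0 ∧ y + y + (y + y) = 0
  · obtain ⟨y, hy, hy2⟩ := hex
    have hinj : ¬ Function.Injective fun x : Γ => x + x := fun hinj =>
      hι (hinj (by simp [hι2]))
    rw [Finite.injective_iff_surjective, Function.Surjective] at hinj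
    push Not at hinj
    obtain ⟨c, hc⟩ := hinj
    refine ⟨y + y, c, hy, hy2, hc, fun x hx => hc (x - y) ?_⟩
    rw [sub_add_sub_comm, hx, add_sub_cancel_right]
  · push Not at hex
    by_contra! hcon
    let D : AddSubgroup Γ := (nsmulAddMonoidHom 2).range
    have hD {x : Γ} : x ∈ D ↔ ∃ y, y + y = x := by
      simp [D, AddMonoidHom.mem_range, two_nsmul]
    have hodd : ¬ 2 ∣ Nat.card D := fun h => by
      obtain ⟨⟨x, hx⟩, h0, h2⟩ := exists_involution h
      obtain ⟨y, rfl⟩ := hD.1 hx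
      exact hex y (by simpa using h0) (by simpa using congrArg Subtype.val h2)
    have hle : Nat.card (Γ ⧸ D) ≤ 2 := by
      have : Function.Surjective
          fun t : Bool => if t then (0 : Γ ⧸ D) else QuotientAddGroup.mk (-ι) := by
        intro q
        obtain ⟨x, rfl⟩ := QuotientAddGroup.mk_surjective q
        by_cases hx : x ∈ D
        · exact ⟨true, by simpa using ((QuotientAddGroup.eq_zero_iff x).2 hx).symm⟩
        · obtain ⟨y, hy⟩ := hcon ι x hι hι2 fun y hy => hx (hD.2 ⟨y, hy⟩)
          refine ⟨false, ?_⟩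
          simp only [Bool.false_eq_true, if_false]
          rw [QuotientAddGroup.eq, neg_neg, add_comm]
          exact hD.2 ⟨y, hy⟩
      simpa using Nat.card_le_card_of_surjective _ this
    rw [AddSubgroup.card_eq_card_quotient_mul_card_addSubgroup D] at h
    have h4 : Nat.Coprime 4 (Nat.card D) :=
      Nat.Coprime.pow_left 2 ((Nat.Prime.coprime_iff_not_dvd Nat.prime_two).2 hodd)
    have := Nat.le_of_dvd Nat.card_pos (h4.dvd_of_dvd_mul_right h)
    omega

theorem MagicRect.of_even {Γ : Type*} [AddCommGroup Γ] [Finite Γ] {a b : ℕ} (ha : Even a)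
    (hb : Even b) (hcard : Nat.card Γ = a * b) : MagicRect Γ a b := by
  obtain ⟨m, rfl⟩ := ha.two_dvd
  obtain ⟨n, rfl⟩ := hb.two_dvd
  have hcard' : Nat.card Γ = m * n * 4 := by rw [hcard]; ring
  obtain ⟨ι, c, hι, hι2, hc, hcι⟩ := exists_involution_not_double (Dvd.intro_left _ hcard'.symm)
  let f : Γ → Bool → Bool → Γ := fun x s t =>
    bif s then (bif t then x + ι else c + ι - x) else bif t then c - x else x
  have hff (x s t s' t') : f (f x s t) s' t' = f x (xor s s') (xor t t') := by
    rcases s <;> rcases t <;> rcases s' <;> rcases t' <;>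
      simp only [f, cond_true, cond_false, Bool.xor_false, Bool.xor_true, Bool.not_false,
        Bool.not_true] <;>
      first
      | abel1
      | rw [← sub_eq_zero]; refine Eq.trans ?_ hι2; abel1
      | rw [← sub_eq_zero, ← neg_eq_zero]; refine Eq.trans ?_ hι2; abel1
  have hff' (x s t) : f (f x s t) s t = x := by simp [hff, f]
  let S : Setoid Γ :=
    { r := fun x y => ∃ s t, f x s t = y
      iseqv :=
        { refl := fun x => ⟨false, false, rfl⟩
          symm := by
            rintro x y ⟨s, t, rfl⟩
            exact ⟨s, t, hff' x s t⟩
          trans := by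
            rintro x y z ⟨s, t, rfl⟩ ⟨s', t', rfl⟩
            exact ⟨_, _, (hff x s t s' t').symm⟩ } }
  have hf (x s t) (h : f x s t = x) : s = false ∧ t = false := by
    rcases s <;> rcases t <;> simp only [f, cond_true, cond_false] at h
    · simp
    · exact absurd (sub_eq_iff_eq_add.1 h).symm (hc x)
    · exact absurd (sub_eq_iff_eq_add.1 h).symm (hcι x)
    · simp [hι] at h
  have hbij : Function.Bijective fun p : Quotient S × Bool × Bool => f p.1.out p.2.1 p.2.2 := by
    constructor
    · rintro ⟨q, s, t⟩ ⟨q', s', t'⟩ h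
      have hout (q : Quotient S) (s t) : (⟦f q.out s t⟧ : Quotient S) = q := by
        conv_rhs => rw [← q.out_eq]
        exact Quotient.sound ⟨s, t, hff' _ s t⟩
      obtain rfl : q = q' := by rw [← hout q s t, ← hout q' s' t']; exact congrArg _ h
      have h' := congrArg (fun x => f x s t) h
      simp only [hff', hff] at h'
      have := hf _ _ _ h'.symm
      simp only [bne_eq_false_iff_eq] at this
      rw [this.1, this.2]
    · intro g
      obtain ⟨s, t, h⟩ : S.r _ _ := Quotient.mk_out (s := S) g
      exact ⟨(⟦g⟧, s, t), h⟩
  have hQ : Nat.card (Quotient S) = m * n := by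
    have := Nat.card_congr (Equiv.ofBijective _ hbij)
    rw [hcard'] at this
    have h2 : Nat.card Bool = 2 := by simp
    rw [Nat.card_prod, Nat.card_prod, h2] at this
    omega
  let e : Fin m × Fin n ≃ Quotient S := (Finite.equivFinOfCardEq hQ |>.trans finProdFinEquiv.symm).symm
  refine of_fintype (ι := Fin m × Bool) (κ := Fin n × Bool) (by simp [mul_comm]) (by simp [mul_comm])
    (fun i j => f (e (i.1, j.1)).out i.2 j.2) (fun g => ?_) (n • c) (m • (c + ι)) (fun i => ?_)
    fun j => ?_
  · obtain ⟨⟨q, s, t⟩, h⟩ := hbij.2 g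
    exact ⟨((e.symm q).1, s), ((e.symm q).2, t), by simpa using h⟩
  · rw [Fintype.sum_prod_type]
    simp only [Fintype.sum_bool]
    rw [sum_congr rfl (g := fun _ => c), sum_const, card_univ, Fintype.card_fin]
    rintro l -
    obtain ⟨k, s⟩ := i
    rcases s <;> simp only [f, cond_true, cond_false]
    · abel
    · rw [← sub_eq_zero]; refine Eq.trans ?_ hι2; abel1
  · rw [Fintype.sum_prod_type]
    simp only [Fintype.sum_bool]
    rw [sum_congr rfl (g := fun _ => c + ι), sum_const, card_univ, Fintype.card_fin]
    rintro k -
    obtain ⟨l, t⟩ := j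
    rcases t <;> simp only [f, cond_true, cond_false] <;> abel

/-- The group has two distinct elements of order two. -/
def TwoInvolutions (G : Type*) [AddCommGroup G] : Prop :=
  ∃ x y : G, x ≠ 0 ∧ y ≠ 0 ∧ x ≠ y ∧ x + x = 0 ∧ y + y = 0

theorem TwoInvolutions.of_mem {G : Type*} [AddCommGroup G] {H : AddSubgroup G} {x y : G}
    (hxH : x ∈ H) (hyH : y ∈ H) (hx : x ≠ 0) (hy : y ≠ 0) (hxy : x ≠ y) (hx2 : x + x = 0)
    (hy2 : y + y = 0) : TwoInvolutions H :=
  ⟨⟨x, hxH⟩, ⟨y, hyH⟩, by simpa, by simpa, by simpa, Subtype.ext hx2, Subtype.ext hy2⟩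

theorem TwoInvolutions.of_injective {G G' : Type*} [AddCommGroup G] [AddCommGroup G']
    (h : TwoInvolutions G) (f : G →+ G') (hf : Function.Injective f) : TwoInvolutions G' := by
  obtain ⟨x, y, hx, hy, hxy, hx2, hy2⟩ := h
  refine ⟨f x, f y, ?_, ?_, hf.ne hxy, ?_, ?_⟩
  · rwa [Ne, map_eq_zero_iff f hf]
  · rwa [Ne, map_eq_zero_iff f hf]
  · rw [← map_add, hx2, map_zero]
  · rw [← map_add, hy2, map_zero]

/-- Three enumerations of `T` summing to zero pointwise, together with half of the indices over
which the last two enumerations have the same sum up to the factor `c`. -/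
def SplitTriple (c : ℕ) (T : Type*) [AddCommGroup T] : Prop :=
  ∃ (α β γ : Fin (Nat.card T) → T) (R : Finset (Fin (Nat.card T))), Function.Surjective α ∧
    Function.Surjective β ∧ Function.Surjective γ ∧ (∀ i, α i + β i + γ i = 0) ∧
    2 * #R = Nat.card T ∧ c • ∑ i ∈ R, (γ i - β i) = 0

namespace SplitTriple

theorem of_fintype {c : ℕ} {T ι : Type*} [AddCommGroup T] [Fintype ι]
    (hι : Fintype.card ι = Nat.card T) (α β γ : ι → T) (R : Finset ι)
    (hα : Function.Surjective α) (hβ : Function.Surjective β) (hγ : Function.Surjective γ)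
    (hsum : ∀ i, α i + β i + γ i = 0) (hR : 2 * #R = Nat.card T)
    (hc : c • ∑ i ∈ R, (γ i - β i) = 0) : SplitTriple c T := by
  let e := Fintype.equivFinOfCardEq hι
  refine ⟨α ∘ e.symm, β ∘ e.symm, γ ∘ e.symm, R.map e.toEmbedding, hα.comp e.symm.surjective,
    hβ.comp e.symm.surjective, hγ.comp e.symm.surjective, fun i => hsum _, by simpa using hR, ?_⟩
  simpa using hc

theorem map {c : ℕ} {T T' : Type*} [AddCommGroup T] [AddCommGroup T'] (e : T ≃+ T')
    (h : SplitTriple c T) : SplitTriple c T' := by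
  obtain ⟨α, β, γ, R, hα, hβ, hγ, hsum, hR, hc⟩ := h
  have hcard := Nat.card_congr e.toEquiv
  refine of_fintype (by simpa using hcard) (e ∘ α) (e ∘ β) (e ∘ γ) R (e.surjective.comp hα)
    (e.surjective.comp hβ) (e.surjective.comp hγ) (fun i => ?_) (hR.trans hcard) ?_
  · simp only [Function.comp_apply, ← map_add, hsum, map_zero]
  · simp only [Function.comp_apply, ← map_sub, ← map_sum, ← map_nsmul, hc, map_zero]

theorem mul_left {c : ℕ} {T : Type*} [AddCommGroup T] (k : ℕ) (h : SplitTriple c T) :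
    SplitTriple (k * c) T := by
  obtain ⟨α, β, γ, R, hα, hβ, hγ, hsum, hR, hc⟩ := h
  exact ⟨α, β, γ, R, hα, hβ, hγ, hsum, hR, by rw [mul_smul, hc, smul_zero]⟩

theorem extend {T : Type*} [AddCommGroup T] [Finite T] {H : AddSubgroup T}
    (h : SplitTriple 4 H) (hH : Nat.card T = 4 * Nat.card H) (h2 : ∀ x : T, x + x ∈ H) :
    SplitTriple 1 T := by
  obtain ⟨α, β, γ, R, hα, hβ, hγ, hsum, hR, hc⟩ := h
  have hindex : Nat.card (T ⧸ H) = 4 := by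
    refine Nat.eq_of_mul_eq_mul_right (Nat.card_pos (α := H)) ?_
    rw [← hH, AddSubgroup.card_eq_card_quotient_mul_card_addSubgroup H]
  have hlt : ∀ F : Finset (T ⧸ H), #F < 4 → ∃ x : T, (x : T ⧸ H) ∉ F := by
    intro F hF
    have := Fintype.ofFinite (T ⧸ H)
    by_contra! hcon
    have : F = univ := eq_univ_of_forall fun q => (QuotientAddGroup.mk_surjective q).elim
      fun x hx => hx ▸ hcon x
    rw [this, card_univ, ← Nat.card_eq_fintype_card, hindex] at hF
    omega
  have h2' (x : T ⧸ H) : x + x = 0 := by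
    obtain ⟨x, rfl⟩ := QuotientAddGroup.mk_surjective x
    exact (QuotientAddGroup.eq_zero_iff (x + x)).2 (h2 x)
  classical
  obtain ⟨s, hs⟩ := hlt {0} (by simp)
  obtain ⟨t, ht⟩ := hlt {0, (s : T ⧸ H)} (card_le_two.trans_lt (by norm_num))
  simp only [mem_singleton, mem_insert, not_or] at hs ht
  let r : Fin 4 → T := ![0, s, t, -s - t]
  have hneg (x : T ⧸ H) : -x = x := neg_eq_of_add_eq_zero_left (h2' x)
  have hrinj : Function.Injective fun k => (r k : T ⧸ H) := by
    have h3 : ((-s - t : T) : T ⧸ H) = s + t := by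
      rw [sub_eq_add_neg, QuotientAddGroup.mk_add, QuotientAddGroup.mk_neg,
        QuotientAddGroup.mk_neg, hneg, hneg]
    have h4 : (s : T ⧸ H) + t ≠ 0 := fun h => ht.2 (by
      rw [← hneg (s : T ⧸ H)]; exact eq_neg_of_add_eq_zero_right h)
    have hs' := Ne.symm hs
    have ht1 := Ne.symm ht.1
    have ht2 := Ne.symm ht.2
    intro k l h
    fin_cases k <;> fin_cases l <;> simp [r, h3, hs, ht.1, ht.2, h4, hs', ht1, ht2, h4.symm] at h ⊢
  have hr (g : T) : ∃ k, g - r k ∈ H := by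
    have hbij := (Nat.bijective_iff_injective_and_card (fun k => (r k : T ⧸ H))).2
      ⟨hrinj, by simp [hindex]⟩
    obtain ⟨k, hk⟩ := hbij.2 (g : T ⧸ H)
    refine ⟨k, ?_⟩
    rw [sub_eq_neg_add]
    exact QuotientAddGroup.eq.1 hk
  let π : Fin 4 ≃ Fin 4 := ⟨![0, 2, 3, 1], ![0, 3, 1, 2], by decide, by decide⟩
  have hsurj {φ : Fin (Nat.card H) → H} (hφ : Function.Surjective φ) (σ : Fin 4 ≃ Fin 4) :
      Function.Surjective fun p : Fin (Nat.card H) × Fin 4 => (φ p.1 : T) + r (σ p.2) := by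
    intro g
    obtain ⟨k, hk⟩ := hr g
    obtain ⟨v, hv⟩ := hφ ⟨_, hk⟩
    exact ⟨(v, σ.symm k), by simp [hv]⟩
  refine of_fintype (ι := Fin (Nat.card H) × Fin 4) (by simp [hH, mul_comm]) _ _ _ (R ×ˢ univ)
    (hsurj hα (Equiv.refl _)) (hsurj hβ π) (hsurj hγ (π.trans π)) ?_ ?_ ?_
  · rintro ⟨v, k⟩
    have h1 : r k + r (π k) + r (π (π k)) = 0 := by
      fin_cases k <;> simp [r, π]
      abel
    have h2 := congrArg Subtype.val (hsum v)
    simp only [AddSubgroup.coe_add, AddSubgroup.coe_zero] at h2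
    simp only [Equiv.refl_apply, Equiv.trans_apply]
    calc _ = ((α v : T) + β v + γ v) + (r k + r (π k) + r (π (π k))) := by abel
      _ = 0 := by rw [h1, h2, add_zero]
  · rw [card_product, card_univ, Fintype.card_fin, ← mul_assoc, hR, hH, mul_comm]
  · rw [one_smul, sum_product]
    have hk : ∑ k, r ((π.trans π) k) = ∑ k, r (π k) := by
      rw [Equiv.sum_comp, Equiv.sum_comp]
    simp only [sum_sub_distrib, sum_add_distrib, hk, sum_const, card_univ, Fintype.card_fin]
    have hc' := congrArg Subtype.val hc
    simp only [AddSubgroup.coe_nsmul, AddSubgroup.val_finsetSum, AddSubgroup.coe_zero,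
      AddSubgroup.coe_sub, sum_sub_distrib] at hc'
    rw [← hc']
    simp only [smul_sub, smul_sum]
    abel

end SplitTriple

theorem card_ker_mul_card_range {G G' : Type*} [AddCommGroup G] [AddCommGroup G']
    (f : G →+ G') : Nat.card f.ker * Nat.card f.range = Nat.card G := by
  rw [← AddSubgroup.index_ker, AddSubgroup.card_mul_index]

theorem addOrderOf_eq_of_two_nsmul {G : Type*} [AddMonoid G] {g : G} {k : ℕ}
    (h : addOrderOf (2 • g) = 2 ^ (k + 1)) : addOrderOf g = 2 ^ (k + 2) := by
  refine addOrderOf_eq_prime_pow (fun h0 => ?_) ?_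
  · rw [pow_succ, mul_smul, ← addOrderOf_dvd_iff_nsmul_eq_zero, h] at h0
    exact absurd (Nat.le_of_dvd (by positivity) h0)
      (not_le.2 (Nat.pow_lt_pow_right (by norm_num) k.lt_succ_self))
  · rw [pow_succ, mul_smul, ← h, addOrderOf_nsmul_eq_zero]

theorem exists_addOrderOf_eq_card {G : Type*} [AddCommGroup G] [Finite G] {k : ℕ}
    (hG : Nat.card G = 2 ^ k) (h : ¬ TwoInvolutions G) : ∃ g : G, addOrderOf g = 2 ^ k := by
  induction k generalizing G with
  | zero => exact ⟨0, by simp⟩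
  | succ k ih =>
    obtain ⟨ι, hι, hι2⟩ := exists_involution (hG ▸ dvd_pow_self 2 k.succ_ne_zero)
    have hker : Nat.card (nsmulAddMonoidHom (α := G) 2).ker = 2 := by
      refine Nat.card_eq_two_iff.2 ⟨0, ⟨ι, by simpa [two_nsmul, AddMonoidHom.mem_ker]⟩,
        fun h => hι (congrArg Subtype.val h).symm, Set.eq_univ_of_forall ?_⟩
      rintro ⟨x, hx⟩
      rw [AddMonoidHom.mem_ker, nsmulAddMonoidHom_apply, two_nsmul] at hx
      simp only [Set.mem_insert_iff, Set.mem_singleton_iff, Subtype.mk.injEq,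
        AddSubgroup.mk_eq_zero]
      by_contra! hcon
      exact h ⟨x, ι, hcon.1, hι, hcon.2, hx, hι2⟩
    have hrange := card_ker_mul_card_range (nsmulAddMonoidHom (α := G) 2)
    rw [hker, hG, pow_succ'] at hrange
    obtain ⟨⟨y, hy⟩, hg⟩ := ih (Nat.eq_of_mul_eq_mul_left two_pos hrange)
      fun h' => h (h'.of_injective (AddSubgroup.subtype _) (AddSubgroup.subtype_injective _))
    obtain ⟨g, rfl⟩ := AddMonoidHom.mem_range.1 hy
    rw [AddSubgroup.addOrderOf_mk, nsmulAddMonoidHom_apply] at hg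
    rcases k with _ | k
    · rw [zero_add, pow_one]
      exact ⟨ι, addOrderOf_eq_prime (by rw [two_nsmul, hι2]) hι⟩
    · exact ⟨g, addOrderOf_eq_of_two_nsmul hg⟩

theorem exists_addEquiv_zmod_prod {T : Type*} [AddCommGroup T] [Finite T] {n : ℕ}
    (hT : Nat.card T = 2 * n) {t e : T} (ht : addOrderOf t = n)
    (he : e ∉ AddSubgroup.zmultiples t) (he2 : e + e = 0) : Nonempty (ZMod 2 × ZMod n ≃+ T) := by
  let φ : ZMod n →+ T := ZMod.lift n ⟨zmultiplesHom T t, by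
    simp [← ht, addOrderOf_nsmul_eq_zero]⟩
  let ψ : ZMod 2 →+ T := ZMod.lift 2 ⟨zmultiplesHom T e, by simpa [two_zsmul]⟩
  have hφ (x : ℤ) : φ x = x • t := by simp [φ]
  have hψ : ψ 1 = e := by
    rw [← Int.cast_one, ZMod.lift_coe]
    simp
  refine ⟨AddEquiv.ofBijective (ψ.coprod φ) ?_⟩
  refine (Nat.bijective_iff_injective_and_card _).2 ⟨?_, by simp [hT]⟩
  rw [injective_iff_map_eq_zero]
  rintro ⟨u, x⟩ h
  obtain ⟨x, rfl⟩ := ZMod.intCast_surjective x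
  rw [AddMonoidHom.coprod_apply, hφ] at h
  fin_cases u
  · change ψ 0 + _ = 0 at h
    rw [map_zero, zero_add, ← addOrderOf_dvd_iff_zsmul_eq_zero, ht] at h
    exact Prod.ext rfl ((ZMod.intCast_zmod_eq_zero_iff_dvd x n).2 h)
  · change ψ 1 + _ = 0 at h
    rw [hψ] at h
    exact absurd ⟨-x, by simpa using (eq_neg_of_add_eq_zero_left h).symm⟩ he

theorem ZMod.sum_val {n : ℕ} [NeZero n] {M : Type*} [AddCommMonoid M] (f : ℕ → M) :
    ∑ x : ZMod n, f x.val = ∑ k ∈ range n, f k :=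
  Finset.sum_nbij' ZMod.val Nat.cast (by simp [ZMod.val_lt]) (by simp) (by simp)
    (fun k hk => by simp [Nat.mod_eq_of_lt (Finset.mem_range.1 hk), ZMod.val_natCast]) (by simp)

theorem SplitTriple.zmod_prod {c m : ℕ} (hm : m ≠ 0) (hc : Even (c * m)) :
    SplitTriple c (ZMod 2 × ZMod (2 * m)) := by
  have : NeZero (2 * m) := ⟨by omega⟩
  let h : ZMod (2 * m) → ZMod 2 := fun x => if x.val < m then 0 else 1
  have hh (x) : h (x + m) = h x + 1 := by
    have hv : ((m : ℕ) : ZMod (2 * m)).val = m := ZMod.val_cast_of_lt (by omega)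
    have hx := ZMod.val_lt x
    simp only [h, ZMod.val_add, hv]
    by_cases hxm : x.val < m
    · rw [if_pos hxm, if_neg, zero_add]
      rw [Nat.mod_eq_of_lt (by omega)]
      omega
    · rw [if_neg hxm, if_pos]
      · decide
      · rw [Nat.mod_eq_sub_mod (by omega), Nat.mod_eq_of_lt] <;> omega
  have hm2 : (m : ZMod (2 * m)) + m = 0 := by
    have := ZMod.natCast_self (2 * m)
    push_cast at this
    rw [← this]
    ring
  have h2 : ∀ u : ZMod 2, u + u = 0 := by decide
  have hsel (u : ZMod 2) (x) : ∃ y, h y = u ∧ y + y = x + x := by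
    by_cases hu : h x = u
    · exact ⟨x, hu, rfl⟩
    · refine ⟨x + m, ?_, ?_⟩
      · rw [hh]
        revert hu
        generalize h x = v
        revert u v
        decide
      · rw [add_add_add_comm, hm2, add_zero]
  have hpar (z : ZMod (2 * m)) : ∃ y, -(y + y) = z ∨ -(y + y) - 1 = z := by
    obtain ⟨n, hn⟩ := ZMod.natCast_zmod_surjective (-z)
    obtain ⟨r, rfl | rfl⟩ := Nat.even_or_odd' n <;> push_cast at hn
    · exact ⟨r, Or.inl (by linear_combination - hn)⟩
    · exact ⟨r, Or.inr (by linear_combination - hn)⟩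
  refine of_fintype (ι := ZMod (2 * m) × Bool) (by simp [mul_comm])
    (fun p => bif p.2 then (h p.1, -(p.1 + p.1)) else (h (p.1 + 1), -(p.1 + p.1) - 1))
    (fun p => bif p.2 then (0, p.1) else (1, p.1))
    (fun p => bif p.2 then (h p.1, p.1) else (h (p.1 + 1) + 1, p.1 + 1))
    (univ ×ˢ {true}) ?_ ?_ ?_ ?_ (by simp) ?_
  · rintro ⟨u, z⟩
    obtain ⟨y, rfl | rfl⟩ := hpar z
    · obtain ⟨x, hx, hxy⟩ := hsel u y
      exact ⟨(x, true), by simp [hx, hxy]⟩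
    · obtain ⟨x, hx, hxy⟩ := hsel u (y + 1)
      refine ⟨(x - 1, false), ?_⟩
      have : -(x - 1 + (x - 1)) - 1 = -(y + y) - 1 := by linear_combination - hxy
      simp only [cond_false, sub_add_cancel, hx, this]
  · rintro ⟨u, z⟩
    fin_cases u
    · exact ⟨(z, true), rfl⟩
    · exact ⟨(z, false), rfl⟩
  · rintro ⟨u, z⟩
    by_cases hu : h z = u
    · exact ⟨(z, true), by simp [hu]⟩
    · refine ⟨(z - 1, false), ?_⟩
      have : h z + 1 = u := by
        revert hu
        generalize h z = v
        revert u v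
        decide
      simp [this]
  · rintro ⟨x, _ | _⟩
    · refine Prod.ext ?_ ?_
      · change h (x + 1) + 1 + (h (x + 1) + 1) = 0
        rw [h2]
      · change -(x + x) - 1 + x + (x + 1) = 0
        ring
    · refine Prod.ext ?_ ?_
      · change h x + 0 + h x = 0
        rw [add_zero, h2]
      · change -(x + x) + x + x = 0
        ring
  · rw [sum_product]
    simp only [sum_singleton, cond_true, Prod.mk_sub_mk, sub_zero, sub_self]
    refine Prod.ext ?_ (by simp [Prod.snd_sum])
    simp only [Prod.smul_fst, Prod.fst_sum, Prod.fst_zero, h]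
    rw [ZMod.sum_val (fun k => if k < m then (0 : ZMod 2) else 1), two_mul, sum_range_add]
    rw [sum_congr rfl fun k hk => if_pos (mem_range.1 hk)]
    simp only [add_lt_iff_neg_left, not_lt_zero, if_false, sum_const, card_range, nsmul_zero,
      zero_add, nsmul_one]
    rw [nsmul_eq_mul, ← Nat.cast_mul]
    exact ZMod.natCast_eq_zero_iff_even.2 hc

theorem SplitTriple.of_card_eight {T : Type*} [AddCommGroup T] (hT : Nat.card T = 8)
    (h2 : ∀ x : T, x + x = 0) : SplitTriple 1 T := by
  let _ : Module (ZMod 2) T := AddCommGroup.zmodModule fun x => by rw [two_nsmul, h2]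
  have : Finite T := Nat.finite_of_card_ne_zero (by omega)
  have hrank : Module.finrank (ZMod 2) T = 3 := by
    have := Module.natCard_eq_pow_finrank (K := ZMod 2) (V := T)
    rw [hT, Nat.card_zmod] at this
    exact (Nat.pow_right_injective le_rfl (by simpa using this)).symm
  let e : (Fin 3 → ZMod 2) ≃+ T :=
    (Module.finBasisOfFinrankEq (ZMod 2) T hrank).equivFun.symm.toAddEquiv
  refine SplitTriple.map e ?_
  refine of_fintype (ι := Fin 3 → ZMod 2) (by simp) id (fun x => ![x 2, x 0 + x 2, x 1])
    (fun x => x + ![x 2, x 0 + x 2, x 1]) {x | x 0 = 0} ?_ ?_ ?_ ?_ ?_ ?_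
  · exact Function.surjective_id
  · decide
  · decide
  · decide
  · simp; decide
  · decide

theorem card_sup_le {G : Type*} [AddCommGroup G] [Finite G] (A B : AddSubgroup G) :
    Nat.card (A ⊔ B : AddSubgroup G) ≤ Nat.card A * Nat.card B := by
  rw [← Nat.card_prod]
  refine Nat.card_le_card_of_surjective (fun p : A × B => (⟨p.1 + p.2,
    add_mem (AddSubgroup.mem_sup_left p.1.2) (AddSubgroup.mem_sup_right p.2.2)⟩ :
      (A ⊔ B : AddSubgroup G))) ?_
  rintro ⟨x, hx⟩
  obtain ⟨y, hy, z, hz, rfl⟩ := AddSubgroup.mem_sup.1 hx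
  exact ⟨(⟨y, hy⟩, ⟨z, hz⟩), rfl⟩

theorem card_zmultiples_of_involution {G : Type*} [AddCommGroup G] {x : G} (hx : x ≠ 0)
    (hx2 : x + x = 0) : Nat.card (AddSubgroup.zmultiples x) = 2 := by
  rw [Nat.card_zmultiples, addOrderOf_eq_prime (by rw [two_nsmul, hx2]) hx]

theorem TwoInvolutions.exists_notMem_zmultiples {G : Type*} [AddCommGroup G] [Finite G]
    (h : TwoInvolutions G) (t : G) : ∃ e ∉ AddSubgroup.zmultiples t, e + e = 0 := by
  obtain ⟨x, y, hx, hy, hxy, hx2, hy2⟩ := h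
  by_contra! hcon
  have hxt : x ∈ AddSubgroup.zmultiples t := by_contra fun h => hcon x h hx2
  have hyt : y ∈ AddSubgroup.zmultiples t := by_contra fun h => hcon y h hy2
  classical
  have := Fintype.ofFinite (AddSubgroup.zmultiples t)
  have hle := IsAddCyclic.card_nsmul_eq_zero_le (α := AddSubgroup.zmultiples t) two_pos
  refine absurd hle (not_le.2 (two_lt_card.2 ⟨0, by simp, ⟨x, hxt⟩, ?_, ⟨y, hyt⟩, ?_, ?_, ?_, ?_⟩))
  · simpa [two_nsmul]
  · simpa [two_nsmul]
  · simpa [Subtype.ext_iff] using hx.symm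
  · simpa [Subtype.ext_iff] using hy.symm
  · simpa [Subtype.ext_iff]

theorem splitTriple_of_two_pow {T : Type*} [AddCommGroup T] [Finite T] {k : ℕ}
    (hT : Nat.card T = 2 ^ k) (h : TwoInvolutions T) :
    SplitTriple 4 T ∧ (Nat.card T ≠ 4 → SplitTriple 1 T) := by
  induction k using Nat.strong_induction_on generalizing T with
  | _ k ih =>
    suffices SplitTriple 1 T ∨ SplitTriple 4 T ∧ (Nat.card T ≠ 4 → SplitTriple 1 T) from
      this.elim (fun h => ⟨h.mul_left 4, fun _ => h⟩) id
    have hcard := card_ker_mul_card_range (nsmulAddMonoidHom (α := T) 2)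
    set D := (nsmulAddMonoidHom (α := T) 2).range with hDdef
    have hD (x : T) : x + x ∈ D := ⟨x, by simp [two_nsmul]⟩
    obtain ⟨l, -, hl⟩ := (Nat.dvd_prime_pow Nat.prime_two).1 (hT ▸ Dvd.intro _ hcard)
    obtain ⟨d, -, hd⟩ := (Nat.dvd_prime_pow Nat.prime_two).1 (hT ▸ Dvd.intro_left _ hcard)
    have hk : k = l + d := by
      rw [hl, hd, hT, ← pow_add] at hcard
      exact (Nat.pow_right_injective le_rfl hcard).symm
    obtain ⟨x, y, hx, hy, hxy, hx2, hy2⟩ := id h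
    have hl2 : 2 ≤ l := by
      have := Fintype.ofFinite (nsmulAddMonoidHom (α := T) 2).ker
      have : 2 < Nat.card (nsmulAddMonoidHom (α := T) 2).ker := by
        rw [Nat.card_eq_fintype_card, Fintype.two_lt_card_iff]
        refine ⟨0, ⟨x, ?_⟩, ⟨y, ?_⟩, ?_, ?_, ?_⟩
        · simpa [AddMonoidHom.mem_ker, two_nsmul]
        · simpa [AddMonoidHom.mem_ker, two_nsmul]
        · simpa [Subtype.ext_iff] using hx.symm
        · simpa [Subtype.ext_iff] using hy.symm
        · simpa [Subtype.ext_iff]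
      by_contra! hlt
      rw [hl] at this
      interval_cases l <;> omega
    have hext (E : AddSubgroup T) (hDE : D ≤ E) {n : ℕ} (hn : n + 2 ≤ k) (hE : Nat.card E ≤ 2 ^ n)
        (h2 : TwoInvolutions E) : SplitTriple 1 T := by
      obtain ⟨e, -, he⟩ := (Nat.dvd_prime_pow Nat.prime_two).1 (hT ▸ E.card_addSubgroup_dvd_card)
      have hen : e ≤ n := (Nat.pow_le_pow_iff_right (by norm_num)).1 (he ▸ hE)
      obtain ⟨H, hEH, hH⟩ := exists_le_addSubgroup_card E (d := 2 ^ (k - 2 - e)) (by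
        rw [he, hT, ← pow_add]
        exact pow_dvd_pow 2 (by omega))
      rw [he, ← pow_add, Nat.sub_add_cancel (by omega)] at hH
      refine (ih (k - 2) (by omega) hH (h2.of_injective (AddSubgroup.inclusion hEH)
        (AddSubgroup.inclusion_injective hEH))).1.extend ?_ fun x => hEH (hDE (hD x))
      rw [hT, hH, show 4 = 2 ^ 2 by rfl, ← pow_add]
      congr 1
      omega
    by_cases hDinv : TwoInvolutions D
    · exact Or.inl (hext D le_rfl (n := d) (by omega) hd.le hDinv)
    obtain rfl | hl3 := hl2.eq_or_lt
    · right
      obtain ⟨t, ht⟩ : ∃ t : T, addOrderOf t = 2 * 2 ^ d := by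
        obtain ⟨⟨g, hgD⟩, hg⟩ := exists_addOrderOf_eq_card hd hDinv
        rcases d with _ | d
        · exact ⟨x, by rw [addOrderOf_eq_prime (by rw [two_nsmul, hx2]) hx]; rfl⟩
        · obtain ⟨t, rfl⟩ := AddMonoidHom.mem_range.1 hgD
          rw [AddSubgroup.addOrderOf_mk, nsmulAddMonoidHom_apply] at hg
          exact ⟨t, by rw [addOrderOf_eq_of_two_nsmul hg]; ring⟩
      obtain ⟨e, he, he2⟩ := h.exists_notMem_zmultiples t
      obtain ⟨f⟩ := exists_addEquiv_zmod_prod (by rw [hT, hk]; ring) ht he he2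
      refine ⟨(SplitTriple.zmod_prod (by positivity) (Even.mul_right (by decide) _)).map f,
        fun h4 => (SplitTriple.zmod_prod (by positivity) ?_).map f⟩
      rw [one_mul, Nat.even_pow]
      refine ⟨even_two, ?_⟩
      rintro rfl
      exact h4 (by rw [hT, hk]; rfl)
    left
    rcases d with _ | d
    · have hDbot : D = ⊥ := AddSubgroup.card_eq_one.1 hd
      have h2 (x : T) : x + x = 0 := by simpa [hDbot] using hD x
      obtain rfl | hl4 := (show 3 ≤ l from hl3).eq_or_lt
      · exact SplitTriple.of_card_eight (by rw [hT, hk]; rfl) h2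
      · refine hext (AddSubgroup.zmultiples x ⊔ AddSubgroup.zmultiples y) (by simp [hDbot]) (n := 2)
          (by omega) ((card_sup_le _ _).trans ?_) (TwoInvolutions.of_mem (AddSubgroup.mem_sup_left
            (AddSubgroup.mem_zmultiples x)) (AddSubgroup.mem_sup_right
            (AddSubgroup.mem_zmultiples y)) hx hy hxy hx2 hy2)
        rw [card_zmultiples_of_involution hx hx2, card_zmultiples_of_involution hy hy2]
        rfl
    · obtain ⟨⟨z, hzD⟩, hz, hz2⟩ := exists_involution (hd ▸ dvd_pow_self 2 d.succ_ne_zero)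
      replace hz : z ≠ 0 := by simpa using hz
      replace hz2 : z + z = 0 := congrArg Subtype.val hz2
      obtain ⟨e, he, hez, he2⟩ : ∃ e, e ≠ 0 ∧ z ≠ e ∧ e + e = 0 := by
        by_cases hzx : z = x
        · exact ⟨y, hy, hzx ▸ hxy, hy2⟩
        · exact ⟨x, hx, hzx, hx2⟩
      refine hext (D ⊔ AddSubgroup.zmultiples e) le_sup_left (n := d + 2) (by omega)
        ((card_sup_le _ _).trans ?_) (TwoInvolutions.of_mem (AddSubgroup.mem_sup_left hzD)
          (AddSubgroup.mem_sup_right (AddSubgroup.mem_zmultiples e)) hz he hez hz2 he2)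
      rw [hd, card_zmultiples_of_involution he he2, ← pow_succ]

theorem exists_balanced_sign {T : Type*} [AddCommGroup T] [Fintype T] (h : 2 ∣ Nat.card T) :
    ∃ r : T → ℤ, (∀ x, r x = 1 ∨ r x = -1) ∧ (∀ x, r (-x) = r x) ∧ ∑ x, r x = 0 := by
  classical
  obtain ⟨n, hn⟩ := h
  obtain ⟨N, hN⟩ := exists_addSubgroup_card (Dvd.intro_left 2 hn.symm)
  have hindex : N.index = 2 := by
    refine Nat.eq_of_mul_eq_mul_left (Nat.card_pos (α := N)) ?_
    rw [N.card_mul_index, hN, hn, mul_comm]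
  obtain ⟨t, ht⟩ : ∃ t, t ∉ N := by
    by_contra! hcon
    rw [(AddSubgroup.eq_top_iff' N).2 hcon, AddSubgroup.index_top] at hindex
    omega
  refine ⟨fun x => if x ∈ N then 1 else -1, fun x => ?_, fun x => by simp, ?_⟩
  · simp only
    split_ifs <;> simp
  · have h : ∑ x, (if x ∈ N then (1 : ℤ) else -1) = ∑ x, -(if x ∈ N then (1 : ℤ) else -1) := by
      rw [← Equiv.sum_comp (Equiv.addRight t)]
      refine sum_congr rfl fun x _ => ?_
      have := AddSubgroup.add_mem_iff_of_index_two hindex (a := x) (b := t)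
      by_cases hx : x ∈ N <;> simp [this, hx, ht]
    rw [sum_neg_distrib] at h
    simp only
    omega

theorem sum_compl_eq_zero_of_odd_function {B M : Type*} [AddCommGroup B] [Fintype B]
    [DecidableEq B] [AddCommGroup M] (hB : Odd (Nat.card B)) {S : Finset B}
    (hS : ∀ x, -x ∈ S ↔ x ∈ S) (h0 : 0 ∈ S) {f : B → M} (hf : ∀ x, x ≠ 0 → f (-x) = -f x) :
    ∑ x ∈ Sᶜ, f x = 0 := by
  have hne {x} (hx : x ∈ Sᶜ) : x ≠ 0 := fun h => mem_compl.1 hx (h ▸ h0)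
  refine sum_involution (fun x _ => -x) (fun x hx => ?_)
    (fun x hx _ => neg_ne_self_of_odd_card hB (hne hx)) (fun x hx => ?_) (fun x _ => neg_neg x)
  · rw [hf x (hne hx), add_neg_cancel]
  · rwa [mem_compl, hS, ← mem_compl]

/-- A rectangle on `T × S` for a symmetric subset `S` of `B` extends to a rectangle on `T × B`. -/
theorem MagicRect.of_core {T B ι κ : Type*} [AddCommGroup T] [AddCommGroup B] [Finite T]
    [Finite B] [Fintype ι] [Fintype κ] (hT : 2 ∣ Nat.card T) (hB : Odd (Nat.card B)) {S : Finset B}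
    (hS : ∀ x, -x ∈ S ↔ x ∈ S) (h0 : 0 ∈ S) (hι : Fintype.card ι = Nat.card T)
    (hκ : Fintype.card κ = #S) (hsum : ∀ [Fintype T], ∑ x : T, x = 0)
    (y : ι → κ → T × B) (hy : ∀ u, ∀ w ∈ S, ∃ i j, y i j = (u, w)) (hr : ∀ i, ∑ j, y i j = 0)
    (hc : ∀ j, ∑ i, y i j = 0) : MagicRect (T × B) (Nat.card T) (Nat.card B) := by
  classical
  have := Fintype.ofFinite T
  have := Fintype.ofFinite B
  obtain ⟨r, hr1, hrneg, hrsum⟩ := exists_balanced_sign hT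
  obtain ⟨s, hs1, hsneg⟩ := exists_odd_sign (B := B)
  let e : T ≃ ι := Fintype.equivOfCardEq (by rw [hι, Nat.card_eq_fintype_card])
  refine of_fintype (ι := T) (κ := κ ⊕ (Sᶜ : Finset B)) Nat.card_eq_fintype_card.symm ?_
    (fun i => Sum.elim (y (e i)) fun j => (s j • i, r i • (j : B))) ?_ 0 0 (fun i => ?_) ?_
  · rw [Fintype.card_sum, hκ, Fintype.card_coe, card_add_card_compl, Nat.card_eq_fintype_card]
  · rintro ⟨u, w⟩
    by_cases hw : w ∈ S
    · obtain ⟨i, j, h⟩ := hy u w hw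
      exact ⟨e.symm i, Sum.inl j, by simpa using h⟩
    · have hjS : r u • w ∈ Sᶜ := by rcases hr1 u with h | h <;> simp [h, hS, hw]
      refine ⟨s (r u • w) • u, Sum.inr ⟨_, hjS⟩, ?_⟩
      have hru : r (s (r u • w) • u) = r u := by
        rcases hs1 (r u • w) with h | h <;> simp [h, hrneg]
      simp only [Sum.elim_inr, hru, smul_smul]
      have h1 : ∀ {a : ℤ}, a = 1 ∨ a = -1 → a * a = 1 := by rintro _ (rfl | rfl) <;> rfl
      rw [h1 (hs1 _), h1 (hr1 _), one_smul, one_smul]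
  · rw [Fintype.sum_sum_type]
    simp only [Sum.elim_inl, Sum.elim_inr, hr, zero_add]
    rw [sum_coe_sort Sᶜ fun j => (s j • i, r i • j)]
    refine sum_compl_eq_zero_of_odd_function hB hS h0 fun x hx => ?_
    rw [hsneg x (neg_ne_self_of_odd_card hB hx)]
    simp
  · rintro (j | j)
    · simp only [Sum.elim_inl]
      rw [Equiv.sum_comp e fun i => y i j, hc]
    · refine Prod.ext ?_ ?_
      · simp only [Sum.elim_inr, Prod.fst_sum, Prod.fst_zero]
        exact smul_sum.symm.trans (by rw [hsum, smul_zero])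
      · simp [Prod.snd_sum, ← sum_smul, hrsum]

theorem SplitTriple.magicRect {T B : Type*} [AddCommGroup T] [AddCommGroup B] [Finite T]
    [Finite B] (h : SplitTriple 1 T) (hT : 2 ∣ Nat.card T) (hB : Odd (Nat.card B))
    (hB1 : 1 < Nat.card B) : MagicRect (T × B) (Nat.card T) (Nat.card B) := by
  classical
  obtain ⟨α, β, γ, R, hα, hβ, hγ, hsum, hR, hc⟩ := h
  have : Nontrivial B := Finite.one_lt_card_iff_nontrivial.1 hB1
  obtain ⟨c, hc0⟩ := exists_ne (0 : B)
  have hcc := neg_ne_self_of_odd_card hB hc0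
  have hbij {φ : Fin (Nat.card T) → T} (hφ : Function.Surjective φ) : Function.Bijective φ :=
    (Nat.bijective_iff_surjective_and_card φ).2 ⟨hφ, by simp⟩
  have htot' [Fintype T] {φ : Fin (Nat.card T) → T} (hφ : Function.Surjective φ) :
      ∑ i, φ i = ∑ x : T, x := (hbij hφ).sum_comp fun x => x
  have hsumT [Fintype T] : ∑ x : T, x = 0 := by
    have h2 : ∑ x : T, x = -∑ x : T, x := by
      rw [← sum_neg_distrib]
      exact (Equiv.sum_comp (Equiv.neg T) fun x => x).symm
    have h3 : ∑ i, (α i + β i + γ i) = 0 := sum_eq_zero fun i _ => hsum i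
    rw [sum_add_distrib, sum_add_distrib, htot' hα, htot' hβ, htot' hγ] at h3
    nth_rw 2 [h2] at h3
    simpa using h3
  have htot {φ : Fin (Nat.card T) → T} (hφ : Function.Surjective φ) : ∑ i, φ i = 0 := by
    have := Fintype.ofFinite T
    rw [htot' hφ, hsumT]
  have hcompl : #Rᶜ = #R := by
    rw [card_compl, Fintype.card_fin]
    omega
  have hite (f g : Fin (Nat.card T) → T × B) :
      ∑ i, (if i ∈ R then f i else g i) = ∑ i ∈ R, f i + ∑ i ∈ Rᶜ, g i := by
    rw [← sum_add_sum_compl R, sum_congr rfl fun i hi => if_pos hi]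
    exact congrArg _ (sum_congr rfl fun i hi => if_neg (mem_compl.1 hi))
  rw [one_smul, sum_sub_distrib, sub_eq_zero] at hc
  refine MagicRect.of_core (S := {0, c, -c}) hT hB ?_ (by simp) (Fintype.card_fin _)
    (κ := Fin 3) ?_ hsumT (fun i => ![(α i, 0), if i ∈ R then (γ i, -c) else (β i, c),
      if i ∈ R then (β i, c) else (γ i, -c)]) ?_ (fun i => ?_) fun j => ?_
  · intro x
    simp only [mem_insert, mem_singleton, neg_eq_iff_eq_neg, neg_zero, neg_neg]
    tauto
  · rw [card_eq_three.2 ⟨0, c, -c, hc0.symm, (neg_ne_zero.2 hc0).symm, hcc.symm, rfl⟩,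
      Fintype.card_fin]
  · intro u w hw
    simp only [mem_insert, mem_singleton] at hw
    rcases hw with rfl | rfl | rfl
    · obtain ⟨i, hi⟩ := hα u
      exact ⟨i, 0, by simp [hi]⟩
    · obtain ⟨i, hi⟩ := hβ u
      by_cases hiR : i ∈ R
      · exact ⟨i, 2, by simp [hi, hiR]⟩
      · exact ⟨i, 1, by simp [hi, hiR]⟩
    · obtain ⟨i, hi⟩ := hγ u
      by_cases hiR : i ∈ R
      · exact ⟨i, 1, by simp [hi, hiR]⟩
      · exact ⟨i, 2, by simp [hi, hiR]⟩
  · rw [Fin.sum_univ_three]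
    by_cases hiR : i ∈ R
    · simpa [hiR, add_right_comm] using hsum i
    · simpa [hiR] using hsum i
  · fin_cases j
    · refine Prod.ext ?_ ?_ <;> simp [Prod.fst_sum, Prod.snd_sum, htot hα]
    · refine (hite _ _).trans (Prod.ext (.trans ?_ (htot hβ)) ?_)
      · rw [← sum_add_sum_compl R β, ← hc]
        simp [Prod.fst_sum]
      · simp [Prod.snd_sum, hcompl]
    · refine (hite _ _).trans (Prod.ext (.trans ?_ (htot hγ)) ?_)
      · rw [← sum_add_sum_compl R γ, hc]
        simp [Prod.fst_sum]
      · simp [Prod.snd_sum, hcompl]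

theorem magicRect_klein_prod_zmod_three : MagicRect ((ZMod 2 × ZMod 2) × ZMod 3) 4 3 :=
  ⟨![![((0, 0), 0), ((0, 1), 1), ((0, 1), 2)], ![((1, 0), 2), ((0, 0), 1), ((1, 0), 0)],
    ![((1, 1), 1), ((1, 1), 0), ((0, 0), 2)], ![((0, 1), 0), ((1, 0), 1), ((1, 1), 2)]],
    by decide, ⟨0, by decide⟩, 0, by decide⟩

theorem sum_zmod_two_prod_zmod_two [h : Fintype (ZMod 2 × ZMod 2)] :
    ∑ x : ZMod 2 × ZMod 2, x = 0 := by
  obtain rfl := Subsingleton.elim h (instFintypeProd _ _)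
  decide

theorem MagicRect.klein_prod {B : Type*} [AddCommGroup B] [Finite B] (hB : Odd (Nat.card B))
    (hB1 : 1 < Nat.card B) : MagicRect ((ZMod 2 × ZMod 2) × B) 4 (Nat.card B) := by
  classical
  by_cases h3 : Nat.card B = 3
  · have : Fact (Nat.Prime 3) := ⟨Nat.prime_three⟩
    rw [h3]
    exact magicRect_klein_prod_zmod_three.map ((AddEquiv.refl _).prodCongr
      (addEquivOfPrimeCardEq (p := 3) (by simp) h3))
  have : Nontrivial B := Finite.one_lt_card_iff_nontrivial.1 hB1
  have := Fintype.ofFinite B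
  obtain ⟨c, hc0⟩ := exists_ne (0 : B)
  obtain ⟨d, hd⟩ : ∃ d, d ∉ ({0, c, -c} : Finset B) := by
    by_contra! hcon
    have := (eq_univ_of_forall hcon ▸ card_le_three : #(univ : Finset B) ≤ 3)
    rw [card_univ, ← Nat.card_eq_fintype_card] at this
    obtain ⟨k, hk⟩ := hB
    omega
  simp only [mem_insert, mem_singleton, not_or] at hd
  obtain ⟨hd0, hdc, hdc'⟩ := hd
  have hcc := neg_ne_self_of_odd_card hB hc0
  have hdd := neg_ne_self_of_odd_card hB hd0
  let y : Fin 4 → Fin 5 → (ZMod 2 × ZMod 2) × ℤ × ℤ :=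
    ![![((0, 1), 0, -1), ((1, 0), 0, 1), ((1, 0), 1, 0), ((0, 1), -1, 0), ((0, 0), 0, 0)],
      ![((0, 0), 0, -1), ((1, 1), 0, 1), ((0, 0), -1, 0), ((0, 1), 1, 0), ((1, 0), 0, 0)],
      ![((0, 1), 0, 1), ((1, 1), 0, -1), ((0, 0), 1, 0), ((1, 1), -1, 0), ((0, 1), 0, 0)],
      ![((0, 0), 0, 1), ((1, 0), 0, -1), ((1, 0), -1, 0), ((1, 1), 1, 0), ((1, 1), 0, 0)]]
  have hy : ∀ u, ∀ w ∈ ({(0, 0), (1, 0), (-1, 0), (0, 1), (0, -1)} : Finset (ℤ × ℤ)),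
      ∃ i j, y i j = (u, w) := by decide
  let f : (ZMod 2 × ZMod 2) × ℤ × ℤ →+ (ZMod 2 × ZMod 2) × B :=
    (AddMonoidHom.id _).prodMap (((zmultiplesHom B) c).coprod ((zmultiplesHom B) d))
  have hf (u p q) : f (u, p, q) = (u, p • c + q • d) := by simp [f]
  have h4 : 4 = Nat.card (ZMod 2 × ZMod 2) := by simp
  rw [h4]
  refine MagicRect.of_core (S := {0, c, -c, d, -d}) (κ := Fin 5) (ι := Fin 4) (by simp) hB ?_
    (by simp) (by simp) ?_ ?_ (fun i j => f (y i j)) ?_ (fun i => ?_) fun j => ?_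
  · intro x
    simp only [mem_insert, mem_singleton, neg_eq_iff_eq_neg, neg_zero, neg_neg]
    tauto
  · rw [card_insert_of_notMem, card_insert_of_notMem, card_insert_of_notMem, card_pair hdd.symm]
    · rfl
    · simp [Ne.symm hdc, Ne.symm hdc', neg_eq_iff_eq_neg]
    · have hcd : c ≠ -d := fun h => hdc' (by rw [h, neg_neg])
      simp [hcc.symm, Ne.symm hdc, hcd]
    · simp [Ne.symm hd0, hc0.symm, (neg_ne_zero.2 hc0).symm, (neg_ne_zero.2 hd0).symm]
  · exact sum_zmod_two_prod_zmod_two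
  · intro u w hw
    have key {p q} (hpq : (p, q) ∈ ({(0, 0), (1, 0), (-1, 0), (0, 1), (0, -1)} : Finset (ℤ × ℤ)))
        (h : p • c + q • d = w) : ∃ i j, f (y i j) = (u, w) := by
      obtain ⟨i, j, hij⟩ := hy u _ hpq
      exact ⟨i, j, by rw [hij, hf, h]⟩
    simp only [mem_insert, mem_singleton] at hw
    rcases hw with rfl | rfl | rfl | rfl | rfl
    · exact key (p := 0) (q := 0) (by decide) (by simp)
    · exact key (p := 1) (q := 0) (by decide) (by simp)
    · exact key (p := -1) (q := 0) (by decide) (by simp)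
    · exact key (p := 0) (q := 1) (by decide) (by simp)
    · exact key (p := 0) (q := -1) (by decide) (by simp)
  · rw [← map_sum, (by decide : ∀ i, ∑ j, y i j = 0), map_zero]
  · rw [← map_sum, (by decide : ∀ j, ∑ i, y i j = 0), map_zero]

theorem MagicRect.of_even_of_odd {Γ : Type*} [AddCommGroup Γ] [Finite Γ] {a b : ℕ} (ha : Even a)
    (hb : Odd b) (hb1 : 1 < b) (hcard : Nat.card Γ = a * b) (h2 : TwoInvolutions Γ) :
    MagicRect Γ a b := by
  induction a using Nat.strong_induction_on generalizing Γ with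
  | _ a ih =>
    obtain ⟨k, rfl⟩ | ⟨q, hq, ⟨a', rfl⟩, hq2⟩ := a.eq_two_pow_or_exists_odd_prime_and_dvd
    · have hk : k ≠ 0 := by
        rintro rfl
        exact absurd ha (by decide)
      obtain ⟨T, B, hT, rfl, ⟨e⟩⟩ := exists_prod_addEquiv hcard
        ((Nat.coprime_two_left.2 hb).pow_left k)
      have hT2 : TwoInvolutions T := by
        obtain ⟨x, y, hx, hy, hxy, hx2, hy2⟩ :=
          h2.of_injective e.symm.toAddMonoidHom e.symm.injective
        have hB {z : T × B} (hz : z + z = 0) : z.2 = 0 :=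
          eq_zero_of_add_self_eq_zero hb (congrArg Prod.snd hz)
        refine ⟨x.1, y.1, fun h => hx (Prod.ext h (hB hx2)), fun h => hy (Prod.ext h (hB hy2)),
          fun h => hxy (Prod.ext h ((hB hx2).trans (hB hy2).symm)), congrArg Prod.fst hx2,
          congrArg Prod.fst hy2⟩
      by_cases h4 : Nat.card T = 4
      · obtain ⟨x, -, hx, -, -, hx2, -⟩ := id hT2
        obtain ⟨z, hz, hz2⟩ := hT2.exists_notMem_zmultiples x
        obtain ⟨f⟩ := exists_addEquiv_zmod_prod (n := 2) h4
          (addOrderOf_eq_prime (by rw [two_nsmul, hx2]) hx) hz hz2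
        rw [← hT, h4]
        exact (klein_prod hb hb1).map ((f.prodCongr (AddEquiv.refl B)).trans e)
      · have := ((splitTriple_of_two_pow hT hT2).2 h4).magicRect (hT ▸ dvd_pow_self 2 hk) hb hb1
        rw [hT] at this
        exact this.map e
    · rw [mul_assoc] at hcard
      obtain ⟨H, hH⟩ := exists_addSubgroup_card (Dvd.intro_left _ hcard.symm)
      have hindex : Nat.card (Γ ⧸ H) = q := by
        refine Nat.eq_of_mul_eq_mul_right (Nat.card_pos (α := H)) ?_
        rw [← AddSubgroup.card_eq_card_quotient_mul_card_addSubgroup H, hcard, hH]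
      have hmem {x : Γ} (hx : x + x = 0) : x ∈ H := by
        rw [← QuotientAddGroup.eq_zero_iff]
        refine eq_zero_of_add_self_eq_zero (hindex ▸ hq2) ?_
        rw [← QuotientAddGroup.mk_add, hx, QuotientAddGroup.mk_zero]
      obtain ⟨x, y, hx, hy, hxy, hx2, hy2⟩ := h2
      have ha' : a' ≠ 0 := by
        rintro rfl
        simp [Nat.card_pos.ne'] at hcard
      refine extend_of_index_odd_prime hq hq2 hb1 (by rw [hcard, hH]) (ih a' ?_ ?_ hH
        (.of_mem (hmem hx2) (hmem hy2) hx hy hxy hx2 hy2))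
      · exact lt_mul_left (Nat.pos_of_ne_zero ha') hq.one_lt
      · exact (Nat.even_mul.1 ha).resolve_left (Nat.not_even_iff_odd.2 hq2)

theorem MagicRect.bijective {Γ : Type*} [Fintype Γ] {a b : ℕ} (hcard : Fintype.card Γ = a * b)
    {x : Fin a → Fin b → Γ} (hx : ∀ g, ∃ i j, x i j = g) :
    Function.Bijective fun p : Fin a × Fin b => x p.1 p.2 := by
  refine (Fintype.bijective_iff_surjective_and_card _).2 ⟨fun g => ?_, by simp [hcard]⟩
  obtain ⟨i, j, h⟩ := hx g
  exact ⟨(i, j), h⟩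

theorem MagicRect.nsmul_sum_univ {Γ : Type*} [AddCommGroup Γ] [Fintype Γ] {a b : ℕ}
    (hcard : Fintype.card Γ = a * b) (h : MagicRect Γ a b) : b • ∑ g : Γ, g = 0 := by
  obtain ⟨x, hx, ⟨ω, hr⟩, -⟩ := h
  rw [← (bijective hcard hx).sum_comp fun g => g, Fintype.sum_prod_type]
  simp only [hr, sum_const, card_univ, Fintype.card_fin]
  rw [smul_smul, mul_comm, ← hcard, card_nsmul_eq_zero]

theorem sum_univ_of_not_twoInvolutions {Γ : Type*} [AddCommGroup Γ] [Fintype Γ]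
    (h : ¬ TwoInvolutions Γ) {ι : Γ} (hι : ι ≠ 0) (hι2 : ι + ι = 0) : ∑ g : Γ, g = ι := by
  classical
  rw [← add_sum_erase univ (fun g => g) (mem_univ ι), add_eq_left]
  refine sum_involution (fun x _ => -x) (fun x _ => add_neg_cancel x) (fun x hx h0 hxx => ?_)
    (fun x hx => ?_) fun x _ => neg_neg x
  · exact h ⟨x, ι, h0, hι, ne_of_mem_erase hx, add_eq_zero_iff_neg_eq.2 hxx, hι2⟩
  · rw [mem_erase, Ne, neg_eq_iff_eq_neg, neg_eq_of_add_eq_zero_left hι2]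
    exact ⟨ne_of_mem_erase hx, mem_univ _⟩

theorem not_magicRect_of_odd {Γ : Type*} [AddCommGroup Γ] [Fintype Γ] {a b : ℕ} (hb : Odd b)
    (hcard : Fintype.card Γ = a * b) (heven : Even (Fintype.card Γ)) (h : ¬ TwoInvolutions Γ) :
    ¬ MagicRect Γ a b := by
  intro hab
  obtain ⟨ι, hι, hι2⟩ := exists_involution (Nat.card_eq_fintype_card (α := Γ) ▸ heven.two_dvd)
  have hsum := hab.nsmul_sum_univ hcard
  obtain ⟨r, rfl⟩ := hb
  rw [sum_univ_of_not_twoInvolutions h hι hι2, add_smul, mul_comm, mul_smul, two_smul, hι2] at hsum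
  simp [hι] at hsum

theorem exists_isMagicRectangleSet_iff {Γ : Type*} [AddCommGroup Γ] [Fintype Γ] {a b : ℕ}
    (hcard : Fintype.card Γ = a * b) :
    (∃ x : Fin 1 → Fin a → Fin b → Γ, IsMagicRectangleSet a b 1 x) ↔ MagicRect Γ a b := by
  constructor
  · rintro ⟨x, hx, ⟨ω, hr⟩, δ, hc⟩
    refine ⟨x 0, fun g => ?_, ⟨ω, hr 0⟩, δ, hc 0⟩
    obtain ⟨⟨s, i, j⟩, h⟩ := hx.2 g
    rw [Subsingleton.elim s 0] at h
    exact ⟨i, j, h⟩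
  · rintro ⟨x, hx, ⟨ω, hr⟩, δ, hc⟩
    exact ⟨fun _ => x, (MagicRect.bijective hcard hx).comp (Equiv.uniqueProd _ (Fin 1)).bijective,
      ⟨ω, fun _ => hr⟩, δ, fun _ => hc⟩

theorem hasMoreThanOneInvolution_iff {Γ : Type*} [AddCommGroup Γ] :
    HasMoreThanOneInvolution Γ ↔ TwoInvolutions Γ := by
  simp only [HasMoreThanOneInvolution, TwoInvolutions, addOrderOf_eq_prime_iff, two_nsmul]
  refine exists_congr fun x => exists_congr fun y => ?_
  tauto

theorem MR_iff (Γ : Type*) [AddCommGroup Γ] [Fintype Γ]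
    (a b : ℕ) (ha : 1 < a) (hb : 1 < b) (hcard : Fintype.card Γ = a * b) :
    (∃ x : Fin 1 → Fin a → Fin b → Γ, IsMagicRectangleSet a b 1 x) ↔
      ((Even a ∧ Even b) ∨ Odd (Fintype.card Γ) ∨ HasMoreThanOneInvolution Γ) := by
  rw [exists_isMagicRectangleSet_iff hcard, hasMoreThanOneInvolution_iff]
  have hcard' : Nat.card Γ = a * b := by rw [Nat.card_eq_fintype_card, hcard]
  have hcard₂ : Nat.card Γ = b * a := by rw [hcard', mul_comm]
  constructor
  · intro h
    by_contra! hcon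
    obtain ⟨hab, heven, h2⟩ := hcon
    rw [Nat.not_odd_iff_even] at heven
    by_cases ha2 : Even a
    · exact not_magicRect_of_odd (Nat.not_even_iff_odd.1 (hab ha2)) hcard heven h2 h
    · exact not_magicRect_of_odd (Nat.not_even_iff_odd.1 ha2) (by rw [hcard, mul_comm]) heven h2
        h.swap
  · intro h
    by_cases ha2 : Even a <;> by_cases hb2 : Even b
    · exact MagicRect.of_even ha2 hb2 hcard'
    all_goals
      have hor : Odd (Nat.card Γ) ∨ TwoInvolutions Γ := by
        rw [Nat.card_eq_fintype_card]
        tauto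
      obtain hodd | h2 := hor
      · exact MagicRect.of_odd ha hb hcard' hodd
    · exact MagicRect.of_even_of_odd ha2 (Nat.not_even_iff_odd.1 hb2) hb hcard' h2
    · exact (MagicRect.of_even_of_odd hb2 (Nat.not_even_iff_odd.1 ha2) ha hcard₂ h2).swap
    · refine MagicRect.of_odd ha hb hcard' ?_
      rw [hcard', Nat.odd_mul]
      exact ⟨Nat.not_even_iff_odd.1 ha2, Nat.not_even_iff_odd.1 hb2⟩
end
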